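/- arXiv:1202.3110 — 8 statements merged into one kernel-verified Lean document; each statement's English description precedes it below -/
import Mathlib

section
/- Let α be a positive integer and let G = (L, P, I) be an α-curve combinatorics with |L| = n. Then for every integer k with 2 ≤ k ≤ n, the number of elements of P adjacent to at least k elements of L satisfies t_k(G) ≤ α·C(n,2)/C(k,2), where C(a,b) denotes the binomial coefficient. -/
open Finset

section Defs

variable {L P : Type*}

/-- The bipartite incidence graph on `L ⊕ P` determined by an adjacency relation
`Adj : L → P → Prop`. -/
def bipartiteGraph (Adj : L → P → Prop) : SimpleGraph (L ⊕ P) :=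
  SimpleGraph.fromRel (fun x y => ∃ l p, Adj l p ∧ x = Sum.inl l ∧ y = Sum.inr p)

/-- The degree of an element `l ∈ L`: the number of elements of `P` adjacent to it. -/
def degL [Fintype P] (Adj : L → P → Prop) [∀ l p, Decidable (Adj l p)] (l : L) : ℕ :=
  (Finset.univ.filter fun p => Adj l p).card

/-- The degree of an element `p ∈ P`: the number of elements of `L` adjacent to it. -/
def degP [Fintype L] (Adj : L → P → Prop) [∀ l p, Decidable (Adj l p)] (p : P) : ℕ :=
  (Finset.univ.filter fun l => Adj l p).card

/-- `tk Adj k` is the number of elements of `P` adjacent to at least `k` elements of `L`. -/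
def tk [Fintype L] [Fintype P] (Adj : L → P → Prop) [∀ l p, Decidable (Adj l p)] (k : ℕ) : ℕ :=
  (Finset.univ.filter fun p => k ≤ degP Adj p).card

/-- `G = (L, P, I)` is an `α`-curve combinatorics: a connected simple bipartite graph
such that every pair of distinct elements of `L` has exactly `α` common neighbors in `P`. -/
def IsCurveComb [Fintype L] [Fintype P] (α : ℕ) (Adj : L → P → Prop)
    [∀ l p, Decidable (Adj l p)] : Prop :=
  (bipartiteGraph Adj).Connected ∧
    ∀ l l' : L, l ≠ l' → (Finset.univ.filter fun p => Adj l p ∧ Adj l' p).card = α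

end Defs

/-- Double counting of the pairs of elements of `L` with a common neighbor. -/
theorem sum_choose_two_degP {L P : Type*} [Fintype L] [Fintype P] (α : ℕ)
    (Adj : L → P → Prop) [∀ l p, Decidable (Adj l p)]
    (h : ∀ l l' : L, l ≠ l' → (Finset.univ.filter fun p => Adj l p ∧ Adj l' p).card = α) :
    ∑ p, (degP Adj p).choose 2 = α * (Fintype.card L).choose 2 := by
  classical
  have key := Finset.sum_card_bipartiteAbove_eq_sum_card_bipartiteBelow
    (s := (univ : Finset L).powersetCard 2) (t := (univ : Finset P))
    (fun e p => ∀ l ∈ e, Adj l p)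
  have above : ∀ e ∈ (univ : Finset L).powersetCard 2,
      (univ.bipartiteAbove (fun e p => ∀ l ∈ e, Adj l p) e).card = α := by
    intro e he
    obtain ⟨a, b, hab, rfl⟩ := Finset.card_eq_two.mp (Finset.mem_powersetCard.mp he).2
    simpa [Finset.bipartiteAbove] using h a b hab
  have below : ∀ p : P, (((univ : Finset L).powersetCard 2).bipartiteBelow
      (fun e p => ∀ l ∈ e, Adj l p) p).card = (degP Adj p).choose 2 := by
    intro p
    rw [degP, ← Finset.card_powersetCard]
    congr 1
    ext e
    simp [Finset.bipartiteBelow, Finset.mem_powersetCard, Finset.subset_iff, and_comm]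
  rw [Finset.sum_congr rfl above, Finset.sum_congr rfl fun p _ => below p] at key
  rw [← key, Finset.sum_const, Finset.card_powersetCard, Finset.card_univ, smul_eq_mul, mul_comm]

/-- For an `α`-curve combinatorics with `|L| = n` and `2 ≤ k ≤ n`,
`t_k(G) ≤ α·C(n,2)/C(k,2)`. -/
theorem stmt_0 {L P : Type*} [Fintype L] [Fintype P] (α : ℕ) (hα : 0 < α)
    (Adj : L → P → Prop) [∀ l p, Decidable (Adj l p)]
    (hG : IsCurveComb α Adj) (n : ℕ) (hn : Fintype.card L = n)
    (k : ℕ) (hk2 : 2 ≤ k) (hkn : k ≤ n) :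
    (tk Adj k : ℝ) ≤ (α : ℝ) * (n.choose 2 : ℝ) / (k.choose 2 : ℝ) := by
  subst hn
  have hpos : 0 < k.choose 2 := Nat.choose_pos hk2
  rw [le_div_iff₀ (by exact_mod_cast hpos)]
  norm_cast
  rw [← sum_choose_two_degP α Adj hG.2, tk, ← smul_eq_mul]
  calc _ ≤ ∑ p with k ≤ degP Adj p, (degP Adj p).choose 2 :=
        Finset.card_nsmul_le_sum _ _ _ fun p hp =>
          Nat.choose_le_choose 2 (Finset.mem_filter.mp hp).2
    _ ≤ _ := Finset.sum_le_sum_of_subset (Finset.filter_subset _ _)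
end

section
/- For every positive integer α there exists a constant c > 0 such that the following holds: if G = (L, P, I) is an α-curve combinatorics with |L| = n ≥ 2 such that no subset of P of size α is adjacent to every element of L (i.e., for every P' ⊆ P with |P'| = α there exists l ∈ L not adjacent to some element of P'), then r(G) ≥ c·n^{1/(α+1)}. -/
open Finset

/-- In a family of finite sets of size at most `r` that meet pairwise in exactly `α` points and
have no `α` points in common, at most `r ^ k` members contain a given set of size `α + 1 - k`. -/
theorem card_filter_superset_le_pow {L P : Type*} [Fintype L] [DecidableEq P]
    (S : L → Finset P) (α r : ℕ) (hL : 1 < Fintype.card L) (hr : ∀ l, (S l).card ≤ r)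
    (hS : ∀ l l', l ≠ l' → (S l ∩ S l').card = α)
    (hcommon : ∀ A : Finset P, A.card = α → ∃ l, ¬ A ⊆ S l) (k : ℕ) :
    ∀ A : Finset P, A.card + k = α + 1 →
      (Finset.univ.filter fun l => A ⊆ S l).card ≤ r ^ k := by
  have : Nontrivial L := Fintype.one_lt_card_iff_nontrivial.mp hL
  induction k with
  | zero =>
    intro A hA
    rw [pow_zero, Finset.card_le_one]
    intro l hl l' hl'
    by_contra hne
    have hsub := Finset.card_le_card (Finset.subset_inter (Finset.mem_filter.mp hl).2
      (Finset.mem_filter.mp hl').2)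
    rw [hS l l' hne] at hsub
    omega
  | succ k ih =>
    intro A hA
    obtain ⟨l₀, hl₀⟩ : ∃ l₀, ∀ l, A ⊆ S l → ∃ p ∈ S l₀, p ∈ S l ∧ p ∉ A := by
      suffices h : ∃ l₀, ∀ l, A ⊆ S l → ¬ S l₀ ∩ S l ⊆ A by
        obtain ⟨l₀, h⟩ := h
        refine ⟨l₀, fun l hl => ?_⟩
        obtain ⟨p, hp, hpA⟩ := Finset.not_subset.mp (h l hl)
        exact ⟨p, (Finset.mem_inter.mp hp).1, (Finset.mem_inter.mp hp).2, hpA⟩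
      rcases Nat.lt_or_ge A.card α with hlt | hge
      · obtain ⟨l₀⟩ : Nonempty L := inferInstance
        refine ⟨l₀, fun l _ hsub => ?_⟩
        have hle := Finset.card_le_card hsub
        rcases eq_or_ne l₀ l with rfl | hne
        · obtain ⟨l', hl'⟩ := exists_ne l₀
          have h₁ := hS l₀ l' hl'.symm
          have h₂ := Finset.card_le_card (Finset.inter_subset_left (s₁ := S l₀) (s₂ := S l'))
          rw [Finset.inter_self] at hle
          omega
        · rw [hS l₀ l hne] at hle
          omega
      · obtain ⟨l₀, hl₀⟩ := hcommon A (by omega)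
        refine ⟨l₀, fun l hl hsub => hl₀ ?_⟩
        have hne : l₀ ≠ l := by
          rintro rfl
          exact hl₀ hl
        have heq := Finset.eq_of_subset_of_card_le hsub (by rw [hS l₀ l hne]; omega)
        exact heq ▸ Finset.inter_subset_left
    classical
    calc (Finset.univ.filter fun l => A ⊆ S l).card
        ≤ ((S l₀ \ A).biUnion fun p => Finset.univ.filter fun l => insert p A ⊆ S l).card := by
          refine Finset.card_le_card fun l hl => ?_
          have hAl := (Finset.mem_filter.mp hl).2
          obtain ⟨p, hp₀, hp, hpA⟩ := hl₀ l hAl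
          exact Finset.mem_biUnion.mpr ⟨p, Finset.mem_sdiff.mpr ⟨hp₀, hpA⟩,
            Finset.mem_filter.mpr ⟨Finset.mem_univ l, Finset.insert_subset hp hAl⟩⟩
      _ ≤ (S l₀ \ A).card * r ^ k := by
          refine Finset.card_biUnion_le_card_mul _ _ _ fun p hp => ih _ ?_
          rw [Finset.card_insert_of_notMem (Finset.mem_sdiff.mp hp).2]
          omega
      _ ≤ r * r ^ k :=
          Nat.mul_le_mul_right _ ((Finset.card_le_card Finset.sdiff_subset).trans (hr l₀))
      _ = r ^ (k + 1) := (pow_succ' r k).symm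

/-- For every positive integer `α` there is a constant `c > 0` such that every
`α`-curve combinatorics with `|L| = n ≥ 2` in which no subset of `P` of size `α` is adjacent
to every element of `L` satisfies `r(G) ≥ c·n^{1/(α+1)}`. -/
theorem stmt_2 (α : ℕ) (hα : 0 < α) :
    ∃ c : ℝ, 0 < c ∧
      ∀ (L P : Type) [Fintype L] [Fintype P] (Adj : L → P → Prop)
        [∀ l p, Decidable (Adj l p)] (n : ℕ),
        IsCurveComb α Adj → Fintype.card L = n → 2 ≤ n →
        (∀ P' : Finset P, P'.card = α → ∃ l : L, ∃ p ∈ P', ¬ Adj l p) →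
        c * (n : ℝ) ^ ((1 : ℝ) / ((α : ℝ) + 1)) ≤ ((Finset.univ.sup (degL Adj) : ℕ) : ℝ) := by
  refine ⟨1, one_pos, ?_⟩
  intro L P _ _ Adj _ n hG hn hn2 hcommon
  classical
  have hle := card_filter_superset_le_pow (fun l => Finset.univ.filter fun p => Adj l p) α
    (Finset.univ.sup (degL Adj)) (by omega)
    (fun l => Finset.le_sup (f := degL Adj) (Finset.mem_univ l))
    (fun l l' h => by
      rw [← Finset.filter_and]
      exact hG.2 l l' h)
    (fun A hA => by
      obtain ⟨l, p, hp, hlp⟩ := hcommon A hA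
      exact ⟨l, fun h => hlp (Finset.mem_filter.mp (h hp)).2⟩)
    (α + 1) ∅ (by simp)
  simp only [Finset.empty_subset, Finset.filter_true, Finset.card_univ, hn] at hle
  have hle' : (n : ℝ) ≤ ((Finset.univ.sup (degL Adj) : ℕ) : ℝ) ^ (α + 1) := by exact_mod_cast hle
  rw [one_mul, one_div, Real.rpow_inv_le_iff_of_pos (by positivity) (by positivity)
    (by positivity)]
  exact_mod_cast hle'
end

section
/- Let α be a positive integer and let G = (L, P, I) be an α-curve combinatorics with |L| = n ≥ 2 such that no subset of P of size α is adjacent to every element of L. Then, writing r = r(G), one has C(r, α)·r ≥ n − 1, where C(a,b) denotes the binomial coefficient. -/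
open Finset

/-- If any two distinct members of a family of sets meet in exactly `α` points, and the `α`-set `S`
is not contained in `N m`, then at most `#(N m)` members of the family contain `S`: apart from `S`
they are pairwise disjoint, and each of them meets `N m` outside `S`. -/
theorem card_filter_subset_le_of_not_subset {L P : Type*} [Fintype L] [DecidableEq P] {α : ℕ}
    {N : L → Finset P} (hN : ∀ l l', l ≠ l' → #(N l ∩ N l') = α) {S : Finset P} (hS : #S = α)
    {m : L} (hm : ¬ S ⊆ N m) : #{l | S ⊆ N l} ≤ #(N m) := by
  refine card_le_card_of_forall_subsingleton (fun l p => p ∈ N l ∧ p ∉ S) ?_ ?_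
  · intro l hl
    have hl : S ⊆ N l := (mem_filter.1 hl).2
    have hne : l ≠ m := by rintro rfl; exact hm hl
    by_contra! h
    have hsub : N l ∩ N m ⊆ S := fun p hp => by
      rw [mem_inter] at hp
      exact h p hp.2 hp.1
    have heq : N l ∩ N m = S := eq_of_subset_of_card_le hsub (by rw [hN l m hne, hS])
    exact hm (heq ▸ inter_subset_right)
  · rintro p - l ⟨hl, hpl, hpS⟩ l' ⟨hl', hpl', -⟩
    by_contra hne
    have heq : S = N l ∩ N l' :=
      eq_of_subset_of_card_le (subset_inter (mem_filter.1 hl).2 (mem_filter.1 hl').2)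
        (by rw [hN l l' hne, hS])
    exact hpS (heq ▸ mem_inter.2 ⟨hpl, hpl'⟩)

/-- For an `α`-curve combinatorics with `|L| = n ≥ 2` in which no subset of `P`
of size `α` is adjacent to every element of `L`, writing `r = r(G)`, one has
`C(r, α)·r ≥ n − 1`. -/
theorem stmt_3 {L P : Type*} [Fintype L] [Fintype P] (α : ℕ) (hα : 0 < α)
    (Adj : L → P → Prop) [∀ l p, Decidable (Adj l p)]
    (hG : IsCurveComb α Adj) (n : ℕ) (hn : Fintype.card L = n) (hn2 : 2 ≤ n)
    (hnd : ∀ P' : Finset P, P'.card = α → ∃ l : L, ∃ p ∈ P', ¬ Adj l p) :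
    n - 1 ≤ ((Finset.univ.sup (degL Adj)).choose α) * (Finset.univ.sup (degL Adj)) := by
  classical
  obtain ⟨l₀⟩ : Nonempty L := Fintype.card_pos_iff.1 (by omega)
  set r := univ.sup (degL Adj) with hr
  let N : L → Finset P := fun l => {p | Adj l p}
  have hNr (l : L) : #(N l) ≤ r := le_sup (f := degL Adj) (mem_univ l)
  have hN (l l' : L) (h : l ≠ l') : #(N l ∩ N l') = α := by
    rw [← hG.2 l l' h, ← filter_and]
  have key : #(univ.erase l₀) ≤ r * #((N l₀).powersetCard α) := by
    refine card_le_mul_card_image_of_maps_to (f := fun l => N l₀ ∩ N l) ?_ r ?_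
    · intro l hl
      exact mem_powersetCard.2 ⟨inter_subset_left, hN l₀ l (ne_of_mem_erase hl).symm⟩
    · intro S hS
      have hSα := (mem_powersetCard.1 hS).2
      obtain ⟨m, p, hp, hmp⟩ := hnd S hSα
      have hm : ¬ S ⊆ N m := fun h => hmp (mem_filter.1 (h hp)).2
      refine le_trans (card_le_card fun l hl => ?_)
        ((card_filter_subset_le_of_not_subset hN hSα hm).trans (hNr m))
      exact mem_filter.2 ⟨mem_univ l, (mem_filter.1 hl).2 ▸ inter_subset_right⟩
  rw [card_erase_of_mem (mem_univ _), card_univ, hn, card_powersetCard] at key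
  calc n - 1 ≤ r * (#(N l₀)).choose α := key
    _ ≤ r * r.choose α := Nat.mul_le_mul_left r (Nat.choose_le_choose α (hNr l₀))
    _ = r.choose α * r := mul_comm _ _
end

section
/- Let α be a positive integer and let G = (L, P, I) be an α-curve combinatorics. Let P' ⊆ P with |P'| = α, and let L' be the set of all elements of L that are adjacent to every element of P'. If l ∈ L \ L' (i.e., l is not adjacent to every element of P'), then l is adjacent to at least |L'| elements of P \ P'; in particular, the degree of l is at least |L'|. -/
open Finset

/-- Let `P' ⊆ P` with `|P'| = α` and let `L'` be the set of elements of `L`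
adjacent to every element of `P'`. If `l` is not adjacent to every element of `P'`, then `l`
is adjacent to at least `|L'|` elements of `P \ P'`; in particular `deg l ≥ |L'|`. -/
theorem stmt_4 {L P : Type*} [Fintype L] [Fintype P] [DecidableEq P] (α : ℕ) (hα : 0 < α)
    (Adj : L → P → Prop) [∀ l p, Decidable (Adj l p)]
    (hG : IsCurveComb α Adj)
    (P' : Finset P) (hP' : P'.card = α)
    (L' : Finset L) (hL' : L' = Finset.univ.filter fun l => ∀ p ∈ P', Adj l p)
    (l : L) (hl : ¬ ∀ p ∈ P', Adj l p) :
    L'.card ≤ (Finset.univ.filter fun p => p ∉ P' ∧ Adj l p).card ∧ L'.card ≤ degL Adj l := by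
  have exists_common : ∀ m ∈ L', ∃ p, p ∉ P' ∧ Adj l p ∧ Adj m p := by
    intro m hm
    rw [hL', Finset.mem_filter] at hm
    have hne : l ≠ m := by
      rintro rfl
      exact hl hm.2
    by_contra! h
    have hsub : (Finset.univ.filter fun p => Adj l p ∧ Adj m p) ⊆ P' := by
      intro p hp
      rw [Finset.mem_filter] at hp
      by_contra hpP
      exact h p hpP hp.2.1 hp.2.2
    have heq := Finset.eq_of_subset_of_card_le hsub (by rw [hG.2 l m hne, hP'])
    refine hl fun p hp => ?_
    rw [← heq, Finset.mem_filter] at hp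
    exact hp.2.1
  have : Nonempty P := ⟨(Finset.card_pos.mp (hP' ▸ hα)).choose⟩
  choose! f hfP hfl hfm using exists_common
  have hcard : L'.card ≤ (Finset.univ.filter fun p => p ∉ P' ∧ Adj l p).card := by
    refine Finset.card_le_card_of_injOn f (fun m hm => by simp [hfP m hm, hfl m hm]) ?_
    intro m hm m' hm' hf
    by_contra hne
    have hsub : insert (f m) P' ⊆ Finset.univ.filter fun p => Adj m p ∧ Adj m' p := by
      intro p hp
      rw [Finset.mem_filter]
      refine ⟨Finset.mem_univ p, ?_⟩
      rcases Finset.mem_insert.mp hp with rfl | hp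
      · exact ⟨hfm m hm, hf ▸ hfm m' hm'⟩
      · rw [Finset.mem_coe, hL', Finset.mem_filter] at hm hm'
        exact ⟨hm.2 p hp, hm'.2 p hp⟩
    have hle := Finset.card_le_card hsub
    rw [Finset.card_insert_of_notMem (hfP m hm), hG.2 m m' hne, hP'] at hle
    omega
  exact ⟨hcard, hcard.trans (Finset.card_le_card (Finset.monotone_filter_right _ fun _ _ h => h.2))⟩
end

section
/- Let α be a positive integer and let G = (L, P, I) be an α-curve combinatorics with |L| = n ≥ 2. Define h(G) to be the maximum, over all subsets P' ⊆ P with |P'| = α, of the number of elements of L adjacent to every element of P'. Then for every l ∈ L with degree g (i.e., adjacent to exactly g elements of P), one has C(g, α)·h(G) ≥ n − 1, where C(a,b) denotes the binomial coefficient. -/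
open Finset

/-- Let `G` be an `α`-curve combinatorics with `|L| = n ≥ 2` and let `h(G)` be
the maximum, over all `P' ⊆ P` with `|P'| = α`, of the number of elements of `L` adjacent to
every element of `P'`. Then for every `l ∈ L` of degree `g`, `C(g, α)·h(G) ≥ n − 1`. -/
theorem stmt_5 {L P : Type*} [Fintype L] [Fintype P] (α : ℕ) (hα : 0 < α)
    (Adj : L → P → Prop) [∀ l p, Decidable (Adj l p)]
    (hG : IsCurveComb α Adj) (n : ℕ) (hn : Fintype.card L = n) (hn2 : 2 ≤ n)
    (l : L) (g : ℕ) (hg : degL Adj l = g) :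
    n - 1 ≤ g.choose α *
      ((Finset.univ.powersetCard α).sup fun P' : Finset P =>
        (Finset.univ.filter fun l' : L => ∀ p ∈ P', Adj l' p).card) := by
  have hle : ∀ Q ∈ (Finset.univ : Finset P).powersetCard α, ∀ s : Finset L,
      (∀ l' ∈ s, ∀ p ∈ Q, Adj l' p) → s.card ≤ _ := fun Q hQ s hs =>
    (Finset.card_le_card fun l' hl' =>
      Finset.mem_filter.2 ⟨Finset.mem_univ l', hs l' hl'⟩).trans <|
    Finset.le_sup (f := fun P' : Finset P =>
      (Finset.univ.filter fun l' : L => ∀ p ∈ P', Adj l' p).card) hQ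
  generalize ((Finset.univ.powersetCard α).sup fun P' : Finset P =>
    (Finset.univ.filter fun l' : L => ∀ p ∈ P', Adj l' p).card) = h at hle ⊢
  classical
  have key : (Finset.univ.erase l).card ≤
      h * ((Finset.univ.filter fun p => Adj l p).powersetCard α).card := by
    refine Finset.card_le_mul_card_image_of_maps_to
      (f := fun l' => Finset.univ.filter fun p => Adj l p ∧ Adj l' p) ?_ h ?_
    · intro l' hl'
      exact Finset.mem_powersetCard.2 ⟨Finset.monotone_filter_right _ fun _ _ hp => hp.1,
        hG.2 l l' (Finset.ne_of_mem_erase hl').symm⟩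
    · intro Q hQ
      refine hle Q (Finset.powersetCard_mono (Finset.subset_univ _) hQ) _ fun l' hl' p hp => ?_
      obtain ⟨-, rfl⟩ := Finset.mem_filter.1 hl'
      exact (Finset.mem_filter.1 hp).2.2
  rw [Finset.card_erase_of_mem (Finset.mem_univ l), Finset.card_univ, hn,
    Finset.card_powersetCard] at key
  rw [← hg, mul_comm]
  exact key
end

section
/- Let α be a positive integer, and let δ, ε, ζ be real constants with ε > 0, 0 ≤ δ < ε/2, and 0 ≤ ζ < 1/2; set γ = max(δ/ε, ζ). For all constants A > 0 and B > 0 there exist constants C > 0 and N such that the following holds: if G = (L, P, I) is an α-curve combinatorics with |L| = n ≥ N, and if t_k(G) ≤ A·(n^{2+δ}/k^{2+ε} + n/k) for every integer k with B·n^ζ ≤ k < n, then either (1) there exists P' ⊆ P with |P'| = α such that every element of L is adjacent to every element of P', or (2) some element of L is adjacent to at least C·n^{1−γ} elements of P. -/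
open Finset

section GeometricSums

theorem sum_pow_le_of_forall_pow_le {x b : ℝ} (hx0 : 0 < x) (hx1 : x < 1) (hb : 0 ≤ b)
    (s : Finset ℕ) (h : ∀ i ∈ s, x ^ i ≤ b) : ∑ i ∈ s, x ^ i ≤ b / (1 - x) := by
  have h1 : 0 < 1 - x := by linarith
  rcases s.eq_empty_or_nonempty with rfl | hs
  · simpa using div_nonneg hb h1.le
  set m := s.min' hs
  have hinj : Set.InjOn (fun i => i - m) (s : Set ℕ) := by
    intro i hi j hj hij
    have := s.min'_le i hi
    have := s.min'_le j hj
    simp only at hij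
    omega
  calc ∑ i ∈ s, x ^ i = x ^ m * ∑ i ∈ s, x ^ (i - m) := by
        rw [mul_sum]
        refine sum_congr rfl fun i hi => ?_
        rw [← pow_add, Nat.add_sub_cancel' (s.min'_le i hi)]
    _ = x ^ m * ∑ j ∈ s.image (fun i => i - m), x ^ j := by rw [sum_image hinj]
    _ ≤ b * (1 - x)⁻¹ := by
        refine mul_le_mul (h m (s.min'_mem hs)) ?_ (sum_nonneg fun _ _ => by positivity) hb
        exact sum_le_hasSum _ (fun _ _ => by positivity)
          (hasSum_geometric_of_lt_one hx0.le hx1)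
    _ = b / (1 - x) := by rw [div_eq_mul_inv]

theorem sum_two_pow_le_of_forall_two_pow_le {b : ℝ} (hb : 0 ≤ b)
    (s : Finset ℕ) (h : ∀ i ∈ s, (2 : ℝ) ^ i ≤ b) : ∑ i ∈ s, (2 : ℝ) ^ i ≤ 2 * b := by
  rcases s.eq_empty_or_nonempty with rfl | hs
  · simpa using hb
  have hlt : ∑ i ∈ s, 2 ^ i < 2 ^ (s.max' hs + 1) :=
    Nat.geomSum_lt le_rfl fun k hk => Nat.lt_succ_of_le (s.le_max' k hk)
  have hlt' : ∑ i ∈ s, (2 : ℝ) ^ i < 2 ^ (s.max' hs + 1) := by exact_mod_cast hlt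
  have := h _ (s.max'_mem hs)
  rw [pow_succ] at hlt'
  linarith

end GeometricSums

section CurveCombinatorics

/-- In an `α`-curve combinatorics, if many lines pass through a common set `T` of `α` points,
then a line missing a point of `T` meets these lines in pairwise distinct points. -/
theorem card_le_degL_of_not_adj {L P : Type*} [Fintype P] (Adj : L → P → Prop)
    [∀ l p, Decidable (Adj l p)] {α : ℕ}
    (h : ∀ l l' : L, l ≠ l' → #{p | Adj l p ∧ Adj l' p} = α)
    {T : Finset P} (hT : #T = α) {F : Finset L} (hF : ∀ l ∈ F, ∀ p ∈ T, Adj l p)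
    {l₀ : L} {p₀ : P} (hp₀ : p₀ ∈ T) (hl₀ : ¬ Adj l₀ p₀) : #F ≤ degL Adj l₀ := by
  classical
  have key : ∀ l ∈ F, ∃ p, (Adj l₀ p ∧ Adj l p) ∧ p ∉ T := by
    intro l hl
    have hne : l₀ ≠ l := fun e => hl₀ (e ▸ hF l hl p₀ hp₀)
    by_contra! hcon
    have hsub : (univ.filter fun p => Adj l₀ p ∧ Adj l p) ⊆ T := fun p hp =>
      hcon p (by simpa using hp)
    have heq := eq_of_subset_of_card_le hsub (by rw [hT, h _ _ hne])
    rw [← heq] at hp₀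
    exact hl₀ (mem_filter.1 hp₀).2.1
  have : Nonempty P := ⟨p₀⟩
  choose! f hf using key
  refine card_le_card_of_injOn f (fun l hl => by simpa using (hf l hl).1.1) ?_
  intro l hl l' hl' hll'
  by_contra hne
  have hsub : insert (f l) T ⊆ univ.filter fun p => Adj l p ∧ Adj l' p := by
    refine insert_subset ?_ fun p hp => by simpa using ⟨hF l hl p hp, hF l' hl' p hp⟩
    simpa using ⟨(hf l hl).1.2, hll' ▸ (hf l' hl').1.2⟩
  have := card_le_card hsub
  rw [card_insert_of_notMem (hf l hl).2, h l l' hne] at this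
  omega

variable {L P : Type*} [Fintype L] [Fintype P] (Adj : L → P → Prop)
  [∀ l p, Decidable (Adj l p)]

theorem sum_degP_eq_sum_card_common (l : L) :
    ∑ p with Adj l p, degP Adj p = ∑ l', #{p | Adj l p ∧ Adj l' p} := by
  simp only [degP, card_filter, sum_filter, ite_and]
  rw [sum_comm]
  refine sum_congr rfl fun p _ => ?_
  split_ifs <;> simp

theorem sum_degP_eq [DecidableEq L] {α : ℕ}
    (h : ∀ l l' : L, l ≠ l' → #{p | Adj l p ∧ Adj l' p} = α) (l : L) :
    ∑ p with Adj l p, degP Adj p = degL Adj l + (Fintype.card L - 1) * α := by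
  rw [sum_degP_eq_sum_card_common, ← add_sum_erase _ _ (mem_univ l),
    sum_congr rfl fun l' hl' => h l l' (ne_of_mem_erase hl').symm]
  simp [degL, card_erase_of_mem]

theorem sum_sum_degP_eq_sum_sq (q : P → Prop) [DecidablePred q] :
    ∑ l, ∑ p with Adj l p ∧ q p, degP Adj p = ∑ p with q p, degP Adj p ^ 2 := by
  simp only [sum_filter]
  rw [sum_comm]
  refine sum_congr rfl fun p _ => ?_
  split_ifs with hq
  · simp [hq, ← sum_filter, degP, sq]
  · simp [hq]

theorem card_exists_common_le (l : L) (q : P → Prop) [DecidablePred q] :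
    #{l' | ∃ p, (Adj l p ∧ q p) ∧ Adj l' p} ≤ ∑ p with Adj l p ∧ q p, degP Adj p := by
  classical
  refine le_trans (card_le_card ?_)
    (card_biUnion_le (s := univ.filter fun p => Adj l p ∧ q p)
      (t := fun p => univ.filter fun l' => Adj l' p))
  intro l' hl'
  simpa using hl'

/-- A dyadic decomposition of the points whose degrees lie between `2 * a` and `b`. -/
theorem sum_sq_degP_le_sum_tk {a b : ℝ} (ha : 0 < a) :
    ∃ s : Finset ℕ, (∀ i ∈ s, a ≤ (2 : ℝ) ^ i ∧ (2 : ℝ) ^ i ≤ b) ∧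
      ∑ p with 2 * a ≤ (degP Adj p : ℝ) ∧ (degP Adj p : ℝ) ≤ b, (degP Adj p : ℝ) ^ 2 ≤
        ∑ i ∈ s, (tk Adj (2 ^ i) : ℝ) * (4 * ((2 : ℝ) ^ i) ^ 2) := by
  classical
  set M := univ.filter fun p => 2 * a ≤ (degP Adj p : ℝ) ∧ (degP Adj p : ℝ) ≤ b
  have hlog : ∀ p ∈ M, 2 ^ Nat.log 2 (degP Adj p) ≤ degP Adj p ∧
      degP Adj p < 2 * 2 ^ Nat.log 2 (degP Adj p) := by
    intro p hp
    have h1 : 0 < (degP Adj p : ℝ) := by linarith [(mem_filter.1 hp).2.1]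
    have h2 : degP Adj p ≠ 0 := by
      rintro h0
      simp [h0] at h1
    refine ⟨Nat.pow_log_le_self 2 h2, ?_⟩
    have := Nat.lt_pow_succ_log_self (b := 2) (by norm_num) (degP Adj p)
    rwa [pow_succ, mul_comm] at this
  refine ⟨M.image fun p => Nat.log 2 (degP Adj p), ?_, ?_⟩
  · intro i hi
    obtain ⟨p, hp, rfl⟩ := mem_image.1 hi
    have h1 : ((2 ^ Nat.log 2 (degP Adj p) : ℕ) : ℝ) ≤ degP Adj p := by
      exact_mod_cast (hlog p hp).1
    have h2 : (degP Adj p : ℝ) < ((2 * 2 ^ Nat.log 2 (degP Adj p) : ℕ) : ℝ) := by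
      exact_mod_cast (hlog p hp).2
    push_cast at h1 h2
    have := (mem_filter.1 hp).2
    constructor <;> linarith
  · rw [← sum_fiberwise_of_maps_to
      (t := M.image fun p => Nat.log 2 (degP Adj p)) (fun p hp => mem_image_of_mem _ hp)]
    refine sum_le_sum fun i _ => ?_
    refine (sum_le_card_nsmul _ _ (4 * ((2 : ℝ) ^ i) ^ 2) ?_).trans ?_
    · intro p hp'
      obtain ⟨hp, rfl⟩ := mem_filter.1 hp'
      have h2 : (degP Adj p : ℝ) < ((2 * 2 ^ Nat.log 2 (degP Adj p) : ℕ) : ℝ) := by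
        exact_mod_cast (hlog p hp).2
      push_cast at h2
      calc (degP Adj p : ℝ) ^ 2 ≤ (2 * 2 ^ Nat.log 2 (degP Adj p)) ^ 2 := by gcongr
        _ = _ := by ring
    · rw [nsmul_eq_mul]
      gcongr
      refine card_le_card fun p hp' => ?_
      obtain ⟨hp, rfl⟩ := mem_filter.1 hp'
      simpa using (hlog p hp).1

/-- An incidence bound on `tk` bounds the number of pairs of lines meeting at points of
intermediate degree. -/
theorem sum_sq_degP_le {δ ε A n a b : ℝ} (hε : 0 < ε) (hA : 0 ≤ A) (hn : 0 ≤ n) (ha : 0 < a)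
    (hb : 0 ≤ b)
    (htk : ∀ k : ℕ, a ≤ (k : ℝ) → (k : ℝ) ≤ b →
      (tk Adj k : ℝ) ≤ A * (n ^ (2 + δ) / (k : ℝ) ^ (2 + ε) + n / (k : ℝ))) :
    ∑ p with 2 * a ≤ (degP Adj p : ℝ) ∧ (degP Adj p : ℝ) ≤ b, (degP Adj p : ℝ) ^ 2 ≤
      4 * A * (n ^ (2 + δ) * (a ^ (-ε) / (1 - 2 ^ (-ε))) + n * (2 * b)) := by
  obtain ⟨s, hs, hle⟩ := sum_sq_degP_le_sum_tk Adj (b := b) ha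
  have hpow : ∀ i : ℕ, ((2 : ℝ) ^ (-ε)) ^ i = ((2 : ℝ) ^ i) ^ (-ε) := fun i => by
    rw [← Real.rpow_natCast, ← Real.rpow_mul (by norm_num), mul_comm,
      Real.rpow_mul (by norm_num), Real.rpow_natCast]
  have h1 : ∑ i ∈ s, ((2 : ℝ) ^ (-ε)) ^ i ≤ a ^ (-ε) / (1 - 2 ^ (-ε)) := by
    refine sum_pow_le_of_forall_pow_le (by positivity)
      (Real.rpow_lt_one_of_one_lt_of_neg (by norm_num) (by linarith)) (by positivity) s ?_
    intro i hi
    rw [hpow]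
    exact Real.rpow_le_rpow_of_nonpos ha (hs i hi).1 (by linarith)
  have h2 : ∑ i ∈ s, (2 : ℝ) ^ i ≤ 2 * b :=
    sum_two_pow_le_of_forall_two_pow_le hb s fun i hi => (hs i hi).2
  calc _ ≤ _ := hle
    _ ≤ ∑ i ∈ s, 4 * A * (n ^ (2 + δ) * ((2 : ℝ) ^ (-ε)) ^ i + n * 2 ^ i) := by
        refine sum_le_sum fun i hi => ?_
        have hk := htk (2 ^ i) (by exact_mod_cast (hs i hi).1) (by exact_mod_cast (hs i hi).2)
        push_cast at hk
        refine (mul_le_mul_of_nonneg_right hk (by positivity)).trans_eq ?_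
        rw [hpow, Real.rpow_neg (by positivity), Real.rpow_add (by positivity) 2 ε]
        have : (0 : ℝ) < ((2 : ℝ) ^ i) ^ ε := by positivity
        norm_num
        field_simp
    _ = 4 * A * (n ^ (2 + δ) * ∑ i ∈ s, ((2 : ℝ) ^ (-ε)) ^ i + n * ∑ i ∈ s, (2 : ℝ) ^ i) := by
        simp only [mul_sum, ← sum_add_distrib]
    _ ≤ _ := by gcongr

/-- If every line has few points, points of intermediate degree account for few pairs of lines,
and `n` is not too small, then a positive proportion of the lines pass through a common set of
`α` points. -/
theorem exists_common_points_of_degL_le {α : ℕ}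
    (h : ∀ l l' : L, l ≠ l' → #{p | Adj l p ∧ Adj l' p} = α)
    (hn : 4 ≤ Fintype.card L) {r c : ℝ} (hc : 0 < c)
    (hdeg : ∀ l, (degL Adj l : ℝ) ≤ Fintype.card L)
    (hlow : ∀ l, (degL Adj l : ℝ) * r ≤ Fintype.card L / 4)
    (hmid : ∑ p with r ≤ (degP Adj p : ℝ) ∧ (degP Adj p : ℝ) ≤ c * Fintype.card L,
      (degP Adj p : ℝ) ^ 2 ≤ (Fintype.card L : ℝ) ^ 2 / 4) :
    ∃ (T : Finset P) (F : Finset L), #T = α ∧ (∀ l ∈ F, ∀ p ∈ T, Adj l p) ∧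
      (Fintype.card L : ℝ) / (4 * 2 ^ ⌊(α + 1) / c⌋₊) ≤ #F := by
  classical
  set n := Fintype.card L with hn_def
  have hn' : (4 : ℝ) ≤ n := by exact_mod_cast hn
  obtain ⟨l, hl⟩ : ∃ l, ∑ p with Adj l p ∧
      (r ≤ (degP Adj p : ℝ) ∧ (degP Adj p : ℝ) ≤ c * n), (degP Adj p : ℝ) ≤ n / 4 := by
    by_contra! hcon
    have : Nonempty L := Fintype.card_pos_iff.1 (by omega)
    have h1 := sum_lt_sum_of_nonempty univ_nonempty fun l (_ : l ∈ univ) => hcon l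
    have h2 := sum_sum_degP_eq_sum_sq Adj
      fun p => r ≤ (degP Adj p : ℝ) ∧ (degP Adj p : ℝ) ≤ c * n
    rw [← @Nat.cast_inj ℝ] at h2
    push_cast at h2
    rw [h2] at h1
    simp only [sum_const, card_univ, nsmul_eq_mul, ← hn_def] at h1
    nlinarith
  set S := univ.filter fun p => Adj l p ∧ c * n < (degP Adj p : ℝ) with hS
  have hScard : #S ≤ ⌊(α + 1) / c⌋₊ := by
    refine Nat.le_floor ?_
    rw [le_div_iff₀ hc]
    have h1 : (#S : ℝ) * (c * n) ≤ ∑ p ∈ S, (degP Adj p : ℝ) := by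
      rw [← nsmul_eq_mul]
      exact card_nsmul_le_sum _ _ _ fun p hp => (mem_filter.1 hp).2.2.le
    have h2 : ∑ p ∈ S, (degP Adj p : ℝ) ≤ ∑ p with Adj l p, (degP Adj p : ℝ) :=
      sum_le_sum_of_subset_of_nonneg
        (fun p hp => by simpa using (mem_filter.1 hp).2.1) fun _ _ _ => by positivity
    have h3 : ∑ p with Adj l p, (degP Adj p : ℝ) = degL Adj l + ((n - 1 : ℕ) : ℝ) * α := by
      exact_mod_cast sum_degP_eq Adj h l
    have h4 : ((n - 1 : ℕ) : ℝ) ≤ n := by exact_mod_cast Nat.sub_le n 1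
    have h5 : ((n - 1 : ℕ) : ℝ) * α ≤ n * α := by gcongr
    have h6 := hdeg l
    have h7 : (#S * c) * (n : ℝ) ≤ (α + 1) * n := by linarith
    exact le_of_mul_le_mul_right h7 (by linarith)
  set bad := univ.filter fun l' => ∃ p, (Adj l p ∧ (degP Adj p : ℝ) ≤ c * n) ∧ Adj l' p
    with hbad
  have hbadcard : (#bad : ℝ) ≤ n / 2 := by
    have h1 : (#bad : ℝ) ≤ ∑ p with Adj l p ∧ (degP Adj p : ℝ) ≤ c * n, (degP Adj p : ℝ) := by
      exact_mod_cast card_exists_common_le Adj l fun p => (degP Adj p : ℝ) ≤ c * n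
    have h2 : ∑ p with Adj l p ∧ (degP Adj p : ℝ) < r, (degP Adj p : ℝ) ≤ n / 4 := by
      rcases (univ.filter fun p => Adj l p ∧ (degP Adj p : ℝ) < r).eq_empty_or_nonempty with
        he | ⟨p, hp⟩
      · rw [he, sum_empty]
        positivity
      have hr : 0 ≤ r := le_trans (by positivity) (mem_filter.1 hp).2.2.le
      refine (sum_le_card_nsmul _ _ r fun p hp => (mem_filter.1 hp).2.2.le).trans ?_
      refine le_trans ?_ (hlow l)
      rw [nsmul_eq_mul]
      gcongr
      exact card_le_card fun p hp => by simpa using (mem_filter.1 hp).2.1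
    have h3 : (univ.filter fun p => Adj l p ∧ (degP Adj p : ℝ) ≤ c * n) ⊆
        (univ.filter fun p => Adj l p ∧ (degP Adj p : ℝ) < r) ∪
        univ.filter fun p => Adj l p ∧ (r ≤ (degP Adj p : ℝ) ∧ (degP Adj p : ℝ) ≤ c * n) := by
      intro p hp
      simp only [mem_filter, mem_univ, true_and, mem_union] at hp ⊢
      rcases lt_or_ge (degP Adj p : ℝ) r with hr | hr
      · exact Or.inl ⟨hp.1, hr⟩
      · exact Or.inr ⟨hp.1, hr, hp.2⟩
    have h4 := sum_le_sum_of_subset_of_nonneg (f := fun p => (degP Adj p : ℝ)) h3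
      fun _ _ _ => by positivity
    have h5 := sum_union_inter (f := fun p => (degP Adj p : ℝ))
      (s₁ := univ.filter fun p => Adj l p ∧ (degP Adj p : ℝ) < r)
      (s₂ := univ.filter fun p =>
        Adj l p ∧ (r ≤ (degP Adj p : ℝ) ∧ (degP Adj p : ℝ) ≤ c * n))
    have h6 : 0 ≤ ∑ p ∈ (univ.filter fun p => Adj l p ∧ (degP Adj p : ℝ) < r) ∩
        univ.filter fun p => Adj l p ∧ (r ≤ (degP Adj p : ℝ) ∧ (degP Adj p : ℝ) ≤ c * n),
        (degP Adj p : ℝ) := sum_nonneg fun _ _ => by positivity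
    linarith
  set good := (univ.erase l) \ bad
  have hgoodcard : (n : ℝ) / 4 ≤ #good := by
    have h1 : #(univ.erase l) ≤ #good + #bad := by
      have : #(univ.erase l) - #bad ≤ #good := le_card_sdiff bad (univ.erase l)
      omega
    rw [card_erase_of_mem (mem_univ l), card_univ, ← hn_def] at h1
    have h2 : (n : ℝ) ≤ #good + #bad + 1 := by
      exact_mod_cast (by omega : n ≤ #good + #bad + 1)
    linarith
  have hmaps : ∀ l' ∈ good, (univ.filter fun p => Adj l p ∧ Adj l' p) ∈ S.powerset := by
    intro l' hl'
    rw [mem_powerset]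
    intro p hp
    have hp := (mem_filter.1 hp).2
    have hnb : l' ∉ bad := (mem_sdiff.1 hl').2
    simp only [hbad, mem_filter, mem_univ, true_and, not_exists, not_and] at hnb
    simp only [hS, mem_filter, mem_univ, true_and]
    exact ⟨hp.1, not_le.1 fun hle => hnb p ⟨hp.1, hle⟩ hp.2⟩
  obtain ⟨T, _, hT⟩ := exists_le_card_fiber_of_nsmul_le_card_of_maps_to
    (b := (n : ℝ) / (4 * 2 ^ ⌊(α + 1) / c⌋₊)) hmaps ⟨∅, empty_mem_powerset S⟩ (by
      refine le_trans ?_ hgoodcard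
      rw [card_powerset, nsmul_eq_mul]
      have h1 : (2 : ℝ) ^ #S ≤ 2 ^ ⌊(α + 1) / c⌋₊ :=
        pow_le_pow_right₀ (by norm_num) hScard
      push_cast
      calc _ ≤ (2 : ℝ) ^ ⌊(α + 1) / c⌋₊ * ((n : ℝ) / (4 * 2 ^ ⌊(α + 1) / c⌋₊)) := by gcongr
        _ = _ := by field_simp)
  refine ⟨T, _, ?_, ?_, hT⟩
  · have hpos : (0 : ℝ) < #(good.filter fun l' => (univ.filter fun p => Adj l p ∧ Adj l' p) = T) :=
      lt_of_lt_of_le (by positivity) hT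
    obtain ⟨l', hmem⟩ := card_pos.1 (by exact_mod_cast hpos)
    obtain ⟨hl', rfl⟩ := mem_filter.1 hmem
    exact h l l' (ne_of_mem_erase (mem_sdiff.1 hl').1).symm
  · intro l' hl' p hp
    obtain ⟨hl', rfl⟩ := mem_filter.1 hl'
    exact (mem_filter.1 hp).2.2

end CurveCombinatorics

/-- With `γ = max(δ/ε, ζ)`, for all `A, B > 0` there are `C > 0` and `N` such
that every `α`-curve combinatorics with `|L| = n ≥ N` satisfying the incidence bound
`t_k(G) ≤ A·(n^{2+δ}/k^{2+ε} + n/k)` for all integers `k` with `B·n^ζ ≤ k < n` either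
contains a `K_{n,α}` (a set `P'` of `α` points adjacent to every element of `L`) or has an
element of `L` adjacent to at least `C·n^{1−γ}` elements of `P`. -/
theorem stmt_6 (α : ℕ) (hα : 0 < α) (δ ε ζ : ℝ) (hε : 0 < ε) (hδ0 : 0 ≤ δ) (hδ : δ < ε / 2)
    (hζ0 : 0 ≤ ζ) (hζ : ζ < 1 / 2) (γ : ℝ) (hγ : γ = max (δ / ε) ζ)
    (A B : ℝ) (hA : 0 < A) (hB : 0 < B) :
    ∃ C : ℝ, 0 < C ∧ ∃ N : ℕ,
      ∀ (L P : Type) [Fintype L] [Fintype P] (Adj : L → P → Prop)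
        [∀ l p, Decidable (Adj l p)] (n : ℕ),
        IsCurveComb α Adj → Fintype.card L = n → N ≤ n →
        (∀ k : ℕ, B * (n : ℝ) ^ ζ ≤ (k : ℝ) → k < n →
          (tk Adj k : ℝ) ≤ A * ((n : ℝ) ^ ((2 : ℝ) + δ) / (k : ℝ) ^ ((2 : ℝ) + ε) +
            (n : ℝ) / (k : ℝ))) →
        ((∃ P' : Finset P, P'.card = α ∧ ∀ (l : L), ∀ p ∈ P', Adj l p) ∨
          ∃ l : L, C * (n : ℝ) ^ (1 - γ) ≤ (degL Adj l : ℝ)) := by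
  have hγδ : δ / ε ≤ γ := hγ ▸ le_max_left _ _
  have hγζ : ζ ≤ γ := hγ ▸ le_max_right _ _
  have hγ0 : 0 ≤ γ := hζ0.trans hγζ
  have hδγ : δ - γ * ε ≤ 0 := by
    have := (div_le_iff₀ hε).1 hγδ
    linarith
  have hq : 0 < 1 - (2 : ℝ) ^ (-ε) :=
    sub_pos.2 (Real.rpow_lt_one_of_one_lt_of_neg (by norm_num) (by linarith))
  obtain ⟨κ, hκ, hBκ⟩ : ∃ κ : ℝ,
      κ ^ (-ε) < (1 - (2 : ℝ) ^ (-ε)) / (32 * A) ∧ B ≤ κ :=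
    (((tendsto_rpow_neg_atTop hε).eventually_lt_const (by positivity)).and
      (Filter.eventually_ge_atTop B)).exists
  have hκ0 : 0 < κ := hB.trans_le hBκ
  set c : ℝ := min (1 / 2) (1 / (64 * A))
  have hc : 0 < c := by positivity
  have hc1 : c ≤ 1 / 2 := min_le_left _ _
  have hcA : 8 * A * c ≤ 1 / 8 := by
    have : c ≤ 1 / (64 * A) := min_le_right _ _
    rw [le_div_iff₀ (by positivity)] at this
    linarith
  set m := ⌊((α : ℝ) + 1) / c⌋₊
  set C : ℝ := min 1 (min (1 / (8 * κ)) (1 / (4 * 2 ^ m)))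
  have hC : 0 < C := by positivity
  have hC1 : C ≤ 1 := min_le_left _ _
  have hCκ : C * (8 * κ) ≤ 1 := by
    rw [← le_div_iff₀ (by positivity)]
    exact (min_le_right _ _).trans (min_le_left _ _)
  have hCm : C ≤ 1 / (4 * 2 ^ m) := (min_le_right _ _).trans (min_le_right _ _)
  refine ⟨C, hC, 4, ?_⟩
  intro L P _ _ Adj _ n hG hcard hn htk
  subst hcard
  set n := Fintype.card L
  have hn4 : (4 : ℝ) ≤ n := by exact_mod_cast hn
  have hn0 : (0 : ℝ) < n := by linarith
  have hn1 : (1 : ℝ) ≤ n := by linarith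
  by_contra! hcon
  obtain ⟨hnot, hdeg⟩ := hcon
  have hpow_le : (n : ℝ) ^ (1 - γ) ≤ n :=
    (Real.rpow_le_rpow_of_exponent_le hn1 (by linarith)).trans_eq (Real.rpow_one _)
  have hmid := sum_sq_degP_le Adj (δ := δ) (A := A) (n := n) (a := κ * (n : ℝ) ^ γ) (b := c * n)
    hε hA.le hn0.le (by positivity) (by positivity) (by
      intro k hk1 hk2
      refine htk k (le_trans ?_ hk1) ?_
      · exact mul_le_mul hBκ (Real.rpow_le_rpow_of_exponent_le hn1 hγζ) (by positivity) hκ0.le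
      · have : (k : ℝ) < n := by nlinarith
        exact_mod_cast this)
  have hmain : (n : ℝ) ^ (2 + δ) * (κ * (n : ℝ) ^ γ) ^ (-ε) ≤ κ ^ (-ε) * (n : ℝ) ^ 2 := by
    rw [Real.mul_rpow hκ0.le (by positivity), ← Real.rpow_mul hn0.le]
    calc _ = κ ^ (-ε) * ((n : ℝ) ^ (2 + δ) * (n : ℝ) ^ (γ * -ε)) := by ring
      _ = κ ^ (-ε) * (n : ℝ) ^ (2 + δ + γ * -ε) := by
          rw [Real.rpow_add hn0 (2 + δ)]
      _ ≤ κ ^ (-ε) * (n : ℝ) ^ (2 : ℝ) := by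
          gcongr
          linarith
      _ = _ := by norm_num
  have hmid' : 4 * A * ((n : ℝ) ^ (2 + δ) * ((κ * (n : ℝ) ^ γ) ^ (-ε) / (1 - 2 ^ (-ε))) +
      n * (2 * (c * n))) ≤ (n : ℝ) ^ 2 / 4 := by
    have h1 : (n : ℝ) ^ (2 + δ) * ((κ * (n : ℝ) ^ γ) ^ (-ε) / (1 - 2 ^ (-ε))) ≤
        (n : ℝ) ^ 2 / (32 * A) := by
      rw [← mul_div_assoc, div_le_iff₀ hq]
      refine hmain.trans ((mul_le_mul_of_nonneg_right hκ.le (by positivity)).trans_eq ?_)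
      ring
    have h2 : 4 * A * ((n : ℝ) ^ 2 / (32 * A)) = (n : ℝ) ^ 2 / 8 := by
      field_simp
      norm_num
    have h3 := mul_le_mul_of_nonneg_left h1 (by positivity : 0 ≤ 4 * A)
    have h4 := mul_le_mul_of_nonneg_right hcA (by positivity : 0 ≤ (n : ℝ) ^ 2)
    linarith
  obtain ⟨T, F, hT, hF, hFcard⟩ := exists_common_points_of_degL_le Adj hG.2 hn
    (r := 2 * (κ * (n : ℝ) ^ γ)) hc
    (fun l => by nlinarith [hdeg l])
    (fun l => by
      have h1 : (n : ℝ) ^ (1 - γ) * (n : ℝ) ^ γ = n := by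
        rw [← Real.rpow_add hn0]
        simp
      calc (degL Adj l : ℝ) * (2 * (κ * (n : ℝ) ^ γ))
          ≤ C * (n : ℝ) ^ (1 - γ) * (2 * (κ * (n : ℝ) ^ γ)) := by
            gcongr
            exact (hdeg l).le
        _ = C * (8 * κ) * ((n : ℝ) ^ (1 - γ) * (n : ℝ) ^ γ) / 4 := by ring
        _ ≤ 1 * n / 4 := by
            rw [h1]
            gcongr
        _ = n / 4 := by rw [one_mul])
    (hmid.trans hmid')
  obtain ⟨l₀, p₀, hp₀, hl₀⟩ := hnot T hT
  have h1 : (#F : ℝ) ≤ degL Adj l₀ := by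
    exact_mod_cast card_le_degL_of_not_adj Adj hG.2 hT hF hp₀ hl₀
  have h2 : C * (n : ℝ) ^ (1 - γ) ≤ n / (4 * 2 ^ m) :=
    calc C * (n : ℝ) ^ (1 - γ) ≤ 1 / (4 * 2 ^ m) * n := by gcongr
      _ = n / (4 * 2 ^ m) := by ring
  linarith [hdeg l₀]
end

section
/- Let α be a positive integer, and let δ, ε, ζ be real constants with ε > 0, 0 ≤ δ < ε/2, and 0 ≤ ζ < 1/2; set γ = max(δ/ε, ζ). For all constants A > 0, B > 0 and every real c with 0 < c < 1, there exist a natural number v and a constant N such that the following holds: if G = (L, P, I) is an α-curve combinatorics with |L| = n ≥ N satisfying t_k(G) ≤ A·(n^{2+δ}/k^{2+ε} + n/k) for every integer k with B·n^ζ ≤ k < n, then the sum of l_i(G) over all integers i with 2^v·n^γ ≤ i ≤ n/2^v is less than c·C(n,2), where C(n,2) = n(n−1)/2. -/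
open Finset

open scoped Classical in
/-- `minCommonDeg Adj l l'` is the minimum degree among the common neighbors of `l` and `l'`
in `P`. -/
noncomputable def minCommonDeg {L P : Type*} [Fintype L] (Adj : L → P → Prop) (l l' : L) : ℕ :=
  sInf ((fun p => degP Adj p) '' {p | Adj l p ∧ Adj l' p})

open scoped Classical in
/-- `lD Adj d` is the number of unordered pairs `{l, l'}` of distinct elements of `L` such
that the minimum degree among the common neighbors of `l` and `l'` equals `d`. -/
noncomputable def lD {L P : Type*} [Fintype L] [Fintype P] (Adj : L → P → Prop) (d : ℕ) : ℕ :=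
  (Finset.univ.filter fun q : Sym2 L => ¬ q.IsDiag ∧
    ∃ l l', q = s(l, l') ∧ minCommonDeg Adj l l' = d).card

lemma lD_le_sq_mul_card {L P : Type*} [Fintype L] [Fintype P] {α : ℕ} (hα : 0 < α)
    (Adj : L → P → Prop) [∀ l p, Decidable (Adj l p)] (hG : IsCurveComb α Adj) (d : ℕ) :
    lD Adj d ≤ d ^ 2 * (univ.filter fun p => degP Adj p = d).card := by
  classical
  have hsub : (univ.filter fun q : Sym2 L => ¬ q.IsDiag ∧
      ∃ l l', q = s(l, l') ∧ minCommonDeg Adj l l' = d) ⊆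
      (univ.filter fun p => degP Adj p = d).biUnion fun p =>
        ((univ.filter fun l => Adj l p) ×ˢ (univ.filter fun l => Adj l p)).image
          fun x => s(x.1, x.2) := by
    intro q hq
    obtain ⟨hdiag, l, l', rfl, hd⟩ := (mem_filter.1 hq).2
    have hne : l ≠ l' := fun h => hdiag (Sym2.mk_isDiag_iff.2 h)
    have hpos : 0 < (univ.filter fun p => Adj l p ∧ Adj l' p).card := by
      rw [hG.2 l l' hne]; exact hα
    obtain ⟨p₀, hp₀⟩ := card_pos.1 hpos
    have hmem := Nat.sInf_mem (s := (fun p => degP Adj p) '' {p | Adj l p ∧ Adj l' p})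
      ⟨_, p₀, (mem_filter.1 hp₀).2, rfl⟩
    obtain ⟨p, hp, hpd⟩ := hmem
    have hpd' : degP Adj p = d := by
      rw [← hd]
      simp only [minCommonDeg]
      convert hpd
    simp only [mem_biUnion, mem_filter, mem_univ, true_and, mem_image, mem_product, Prod.exists]
    exact ⟨p, hpd', l, l', ⟨hp.1, hp.2⟩, rfl⟩
  have hcard : lD Adj d = (univ.filter fun q : Sym2 L => ¬ q.IsDiag ∧
      ∃ l l', q = s(l, l') ∧ minCommonDeg Adj l l' = d).card := by
    unfold lD
    congr
  rw [hcard, mul_comm, ← smul_eq_mul]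
  refine (card_le_card hsub).trans (card_biUnion_le.trans (sum_le_card_nsmul _ _ _ ?_))
  intro p hp
  refine card_image_le.trans ?_
  rw [card_product, ← (mem_filter.1 hp).2, sq]
  rfl

lemma sum_lD_le_sum_tk {L P : Type*} [Fintype L] [Fintype P] {α : ℕ} (hα : 0 < α)
    (Adj : L → P → Prop) [∀ l p, Decidable (Adj l p)] (hG : IsCurveComb α Adj)
    (s : Finset ℕ) (hs : ∀ i ∈ s, i ≠ 0) :
    ∑ i ∈ s, lD Adj i ≤ ∑ j ∈ s.image (Nat.log 2), (2 ^ (j + 1)) ^ 2 * tk Adj (2 ^ j) := by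
  classical
  rw [← sum_fiberwise_of_maps_to (fun i hi => mem_image_of_mem (Nat.log 2) hi)]
  refine sum_le_sum fun j _ => ?_
  calc ∑ i ∈ s with Nat.log 2 i = j, lD Adj i
      ≤ ∑ i ∈ s with Nat.log 2 i = j,
          (2 ^ (j + 1)) ^ 2 * (univ.filter fun p => degP Adj p = i).card := by
        refine sum_le_sum fun i hi => (lD_le_sq_mul_card hα Adj hG i).trans ?_
        obtain ⟨-, rfl⟩ := mem_filter.1 hi
        gcongr
        exact (Nat.lt_pow_succ_log_self one_lt_two i).le
    _ ≤ (2 ^ (j + 1)) ^ 2 * tk Adj (2 ^ j) := by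
        rw [← mul_sum, sum_card_fiberwise_eq_card_filter]
        refine Nat.mul_le_mul_left _ (card_le_card fun p hp => ?_)
        simp only [mem_filter, mem_univ, true_and] at hp ⊢
        calc 2 ^ j = 2 ^ Nat.log 2 (degP Adj p) := by rw [hp.2]
          _ ≤ degP Adj p := Nat.pow_log_le_self 2 (hs _ hp.1)

lemma sum_pow_le_div_one_sub {r x : ℝ} (hr0 : 0 ≤ r) (hr1 : r < 1) (hx : 0 ≤ x)
    (J : Finset ℕ) (hJ : ∀ j ∈ J, r ^ j ≤ x) : ∑ j ∈ J, r ^ j ≤ x / (1 - r) := by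
  have h1 : 0 < 1 - r := sub_pos.2 hr1
  rcases J.eq_empty_or_nonempty with rfl | hne
  · simpa using div_nonneg hx h1.le
  set m := J.min' hne
  have hsum := (hasSum_geometric_of_lt_one hr0 hr1).mul_left (r ^ m)
  calc ∑ j ∈ J, r ^ j = ∑ k ∈ J.image (· - m), r ^ m * r ^ k := by
        rw [sum_image]
        · refine sum_congr rfl fun j hj => ?_
          rw [← pow_add, Nat.add_sub_cancel' (J.min'_le j hj)]
        · intro i hi j hj hij
          have := J.min'_le i hi
          have := J.min'_le j hj
          simp only at hij
          omega
    _ ≤ r ^ m * (1 - r)⁻¹ := sum_le_hasSum _ (fun k _ => by positivity) hsum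
    _ ≤ x / (1 - r) := by
        rw [div_eq_mul_inv]
        gcongr
        exact hJ m (J.min'_mem hne)

lemma sum_two_pow_le {x : ℝ} (hx : 0 ≤ x) (J : Finset ℕ) (hJ : ∀ j ∈ J, (2 : ℝ) ^ j ≤ x) :
    ∑ j ∈ J, (2 : ℝ) ^ j ≤ 2 * x := by
  rcases J.eq_empty_or_nonempty with rfl | hne
  · simpa using hx
  have h := Nat.geomSum_lt (m := 2) le_rfl (n := J.max' hne + 1) fun k hk =>
    Nat.lt_succ_of_le (J.le_max' k hk)
  have h' : ∑ j ∈ J, (2 : ℝ) ^ j ≤ 2 ^ (J.max' hne + 1) := by exact_mod_cast h.le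
  have := hJ _ (J.max'_mem hne)
  rw [pow_succ] at h'
  linarith

/-- The exponent `w` is chosen so that both geometric tails are negligible. -/
lemma exists_dyadic_cutoff {r A B c : ℝ} (hr0 : 0 ≤ r) (hr1 : r < 1) (hc : 0 < c) :
    ∃ w : ℕ, B ≤ 2 ^ w ∧ 4 * A * (r ^ w / (1 - r) + (1 / 2) ^ w) < c / 4 := by
  have h : Filter.Tendsto (fun w : ℕ => 4 * A * (r ^ w / (1 - r) + (1 / 2 : ℝ) ^ w))
      Filter.atTop (nhds (4 * A * (0 / (1 - r) + 0))) :=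
    (((tendsto_pow_atTop_nhds_zero_of_lt_one hr0 hr1).div_const _).add
      (tendsto_pow_atTop_nhds_zero_of_lt_one (by norm_num) (by norm_num))).const_mul _
  have hlt : 4 * A * (0 / (1 - r) + 0) < c / 4 := by simp; linarith
  have hB := (tendsto_pow_atTop_atTop_of_one_lt (one_lt_two : (1 : ℝ) < 2)).eventually_ge_atTop B
  exact (hB.and (h.eventually_lt_const hlt)).exists

/-- One dyadic level of the incidence bound, multiplied by the square of the level. -/
lemma sq_mul_incidence_bound (A n δ ε : ℝ) (j : ℕ) :
    ((2 : ℝ) ^ (j + 1)) ^ 2 *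
        (A * (n ^ ((2 : ℝ) + δ) / ((2 : ℝ) ^ j) ^ ((2 : ℝ) + ε) + n / 2 ^ j)) =
      4 * A * (n ^ ((2 : ℝ) + δ) * ((2 : ℝ) ^ (-ε)) ^ j + n * 2 ^ j) := by
  have hpos : (0 : ℝ) < 2 ^ j := by positivity
  have hr : ((2 : ℝ) ^ (-ε)) ^ j = (((2 : ℝ) ^ j) ^ ε)⁻¹ := by
    rw [← Real.rpow_natCast, ← Real.rpow_mul two_pos.le, mul_comm,
      Real.rpow_mul two_pos.le, Real.rpow_natCast, Real.rpow_neg hpos.le]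
  have hε : (((2 : ℝ) ^ j) ^ ε) ≠ 0 := (Real.rpow_pos_of_pos hpos ε).ne'
  rw [hr, Real.rpow_add hpos, Real.rpow_two, pow_succ]
  field_simp
  ring

/-- With `γ = max(δ/ε, ζ)`, for all `A, B > 0` and `0 < c < 1` there are `v` and
`N` such that every `α`-curve combinatorics with `|L| = n ≥ N` satisfying the incidence bound
`t_k(G) ≤ A·(n^{2+δ}/k^{2+ε} + n/k)` for all integers `k` with `B·n^ζ ≤ k < n` has
`∑_{2^v·n^γ ≤ i ≤ n/2^v} l_i(G) < c·C(n,2)`. -/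
theorem stmt_7 (α : ℕ) (hα : 0 < α) (δ ε ζ : ℝ) (hε : 0 < ε) (hδ0 : 0 ≤ δ) (hδ : δ < ε / 2)
    (hζ0 : 0 ≤ ζ) (hζ : ζ < 1 / 2) (γ : ℝ) (hγ : γ = max (δ / ε) ζ)
    (A B c : ℝ) (hA : 0 < A) (hB : 0 < B) (hc0 : 0 < c) (hc1 : c < 1) :
    ∃ v : ℕ, ∃ N : ℕ,
      ∀ (L P : Type) [Fintype L] [Fintype P] (Adj : L → P → Prop)
        [∀ l p, Decidable (Adj l p)] (n : ℕ),
        IsCurveComb α Adj → Fintype.card L = n → N ≤ n →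
        (∀ k : ℕ, B * (n : ℝ) ^ ζ ≤ (k : ℝ) → k < n →
          (tk Adj k : ℝ) ≤ A * ((n : ℝ) ^ ((2 : ℝ) + δ) / (k : ℝ) ^ ((2 : ℝ) + ε) +
            (n : ℝ) / (k : ℝ))) →
        (∑ i ∈ Finset.Icc ⌈(2 ^ v : ℝ) * (n : ℝ) ^ γ⌉₊ ⌊(n : ℝ) / 2 ^ v⌋₊, (lD Adj i : ℝ))
          < c * ((n : ℝ) * ((n : ℝ) - 1) / 2) := by
  set r : ℝ := (2 : ℝ) ^ (-ε) with hr
  have hr0 : 0 < r := Real.rpow_pos_of_pos two_pos _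
  have hr1 : r < 1 := Real.rpow_lt_one_of_one_lt_of_neg one_lt_two (neg_lt_zero.2 hε)
  obtain ⟨w, hBw, hw⟩ := exists_dyadic_cutoff (A := A) (B := B) hr0.le hr1 hc0
  refine ⟨w + 1, 2, ?_⟩
  intro L P _ _ Adj _ n hG _ hn htk
  have hn2 : (2 : ℝ) ≤ n := by exact_mod_cast hn
  have hn0 : (0 : ℝ) < n := by linarith
  have hn1 : (1 : ℝ) ≤ n := by linarith
  have hγζ : ζ ≤ γ := hγ ▸ le_max_right _ _
  have hγδ : δ ≤ γ * ε := by
    rw [← div_le_iff₀ hε, hγ]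
    exact le_max_left _ _
  have hnγ : (0 : ℝ) < (n : ℝ) ^ γ := Real.rpow_pos_of_pos hn0 γ
  set s := Icc ⌈(2 ^ (w + 1) : ℝ) * (n : ℝ) ^ γ⌉₊ ⌊(n : ℝ) / 2 ^ (w + 1)⌋₊
  have hs : ∀ i ∈ s, i ≠ 0 := fun i hi =>
    ((Nat.ceil_pos.2 (by positivity)).trans_le (mem_Icc.1 hi).1).ne'
  set J := s.image (Nat.log 2)
  have hJ : ∀ j ∈ J, 2 ^ w * (n : ℝ) ^ γ ≤ 2 ^ j ∧ (2 : ℝ) ^ j ≤ n / 2 ^ (w + 1) := by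
    intro j hj
    obtain ⟨i, hi, rfl⟩ := mem_image.1 hj
    have hlo : (2 ^ (w + 1) : ℝ) * (n : ℝ) ^ γ ≤ i := Nat.ceil_le.1 (mem_Icc.1 hi).1
    have hhi : (i : ℝ) ≤ n / 2 ^ (w + 1) :=
      (Nat.le_floor_iff (by positivity)).1 (mem_Icc.1 hi).2
    have h1 : (2 : ℝ) ^ Nat.log 2 i ≤ i := by exact_mod_cast Nat.pow_log_le_self 2 (hs i hi)
    have h2 : (i : ℝ) ≤ 2 ^ (Nat.log 2 i + 1) := by
      exact_mod_cast (Nat.lt_pow_succ_log_self one_lt_two i).le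
    rw [pow_succ] at hlo h2
    exact ⟨by linarith, h1.trans hhi⟩
  have hlevel : ∀ j ∈ J, ((2 : ℝ) ^ (j + 1)) ^ 2 * (tk Adj (2 ^ j) : ℝ) ≤
      4 * A * ((n : ℝ) ^ ((2 : ℝ) + δ) * r ^ j + n * 2 ^ j) := by
    intro j hj
    obtain ⟨hlo, hhi⟩ := hJ j hj
    have hB' : B * (n : ℝ) ^ ζ ≤ ((2 ^ j : ℕ) : ℝ) := by
      push_cast
      refine le_trans ?_ hlo
      gcongr
    have hlt : 2 ^ j < n := by
      have h : (2 : ℝ) ^ j < n :=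
        hhi.trans_lt (div_lt_self hn0 (one_lt_pow₀ one_lt_two (Nat.succ_ne_zero w)))
      exact_mod_cast h
    have := htk (2 ^ j) hB' hlt
    push_cast at this
    rw [hr, ← sq_mul_incidence_bound]
    gcongr
  have hgeom : ∑ j ∈ J, r ^ j ≤ (r ^ w * (n : ℝ) ^ (-(γ * ε))) / (1 - r) := by
    refine sum_pow_le_div_one_sub hr0.le hr1 (by positivity) J fun j hj => ?_
    have hpow : ∀ k : ℕ, r ^ k = ((2 : ℝ) ^ k) ^ (-ε) := fun k => by
      rw [hr, ← Real.rpow_natCast, ← Real.rpow_mul two_pos.le, mul_comm,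
        Real.rpow_mul two_pos.le, Real.rpow_natCast]
    rw [hpow, hpow, ← mul_neg, Real.rpow_mul hn0.le, ← Real.mul_rpow (by positivity) hnγ.le]
    exact Real.rpow_le_rpow_of_nonpos (by positivity) (hJ j hj).1 (by linarith)
  have hfirst : (n : ℝ) ^ ((2 : ℝ) + δ) * ∑ j ∈ J, r ^ j ≤ n ^ 2 * (r ^ w / (1 - r)) := by
    have h1r : 0 < 1 - r := sub_pos.2 hr1
    calc (n : ℝ) ^ ((2 : ℝ) + δ) * ∑ j ∈ J, r ^ j
        ≤ (n : ℝ) ^ ((2 : ℝ) + δ) * ((r ^ w * (n : ℝ) ^ (-(γ * ε))) / (1 - r)) := by gcongr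
      _ = (n : ℝ) ^ ((2 : ℝ) + δ + -(γ * ε)) * (r ^ w / (1 - r)) := by
          rw [Real.rpow_add hn0 _ (-(γ * ε))]; ring
      _ ≤ (n : ℝ) ^ (2 : ℝ) * (r ^ w / (1 - r)) := by
          gcongr
          linarith
      _ = n ^ 2 * (r ^ w / (1 - r)) := by rw [Real.rpow_two]
  have hsecond : (n : ℝ) * ∑ j ∈ J, (2 : ℝ) ^ j ≤ n ^ 2 * (1 / 2) ^ w := by
    calc (n : ℝ) * ∑ j ∈ J, (2 : ℝ) ^ j ≤ n * (2 * (n / 2 ^ (w + 1))) := by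
          gcongr
          exact sum_two_pow_le (by positivity) J fun j hj => (hJ j hj).2
      _ = n ^ 2 * (1 / 2) ^ w := by
          rw [pow_succ, one_div, inv_pow]
          field_simp
  calc ∑ i ∈ s, (lD Adj i : ℝ)
      ≤ ∑ j ∈ J, ((2 : ℝ) ^ (j + 1)) ^ 2 * (tk Adj (2 ^ j) : ℝ) := by
        exact_mod_cast sum_lD_le_sum_tk hα Adj hG s hs
    _ ≤ ∑ j ∈ J, 4 * A * ((n : ℝ) ^ ((2 : ℝ) + δ) * r ^ j + n * 2 ^ j) := sum_le_sum hlevel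
    _ = 4 * A * ((n : ℝ) ^ ((2 : ℝ) + δ) * ∑ j ∈ J, r ^ j + n * ∑ j ∈ J, (2 : ℝ) ^ j) := by
        rw [← mul_sum, sum_add_distrib, ← mul_sum, ← mul_sum]
    _ ≤ 4 * A * (n ^ 2 * (r ^ w / (1 - r)) + n ^ 2 * (1 / 2) ^ w) := by gcongr
    _ = n ^ 2 * (4 * A * (r ^ w / (1 - r) + (1 / 2) ^ w)) := by ring
    _ < n ^ 2 * (c / 4) := by gcongr
    _ ≤ c * ((n : ℝ) * ((n : ℝ) - 1) / 2) := by
        nlinarith [mul_nonneg hc0.le (mul_nonneg hn0.le (sub_nonneg.2 hn2))]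
end

section
/- Let ε > 0 be real, let p ≥ 1 and d ≥ 2p be integers. There exists a constant c > 0 (depending only on p, d, and ε) such that the following holds: let L be a finite family of n distinct p-dimensional affine subspaces of ℝ^d such that every two distinct members of L intersect in exactly one point. Then either all members of L pass through a single common point, or there exists a member F of L such that the number of points x for which x ∈ F and x ∈ F' for some F' ∈ L distinct from F is at least c·n^{1−ε}. -/
section LinearIncidences

open Matrix Module

theorem exists_linearIndepOn_weight {ι κ : Type*} [Fintype ι] [Fintype κ]
    (u : ι → κ → ℝ) (ρ : ℝ) (hρ : 0 ≤ ρ)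
    (hu : ∀ X : Submodule ℝ (κ → ℝ), (Nat.card {i // u i ∈ X} : ℝ) * ρ ≤ finrank ℝ X)
    (t : ι → ℝ) (s : Finset ι) :
    ∃ S ⊆ s, LinearIndepOn ℝ u (S : Set ι) ∧
      (∀ i ∈ s, u i ∈ Submodule.span ℝ (u '' (S : Set ι))) ∧
      ∀ τ, (∀ i ∈ s, τ ≤ t i) →
        τ * (S.card - s.card * ρ) ≤ ∑ i ∈ S, t i - ρ * ∑ i ∈ s, t i := by
  classical
  induction s using Finset.induction_on_min_value t with
  | empty => exact ⟨∅, subset_rfl, by simp, by simp, by simp⟩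
  | insert a s has hmin ih =>
    obtain ⟨S, hSs, hind, hspan, hS⟩ := ih
    have haS : a ∉ S := fun h => has (hSs h)
    have key : ∃ S' ⊆ insert a s, LinearIndepOn ℝ u (S' : Set ι) ∧
        (∀ i ∈ insert a s, u i ∈ Submodule.span ℝ (u '' (S' : Set ι))) ∧
        ∑ i ∈ S', t i - t a * S'.card = ∑ i ∈ S, t i - t a * S.card := by
      by_cases h : u a ∈ Submodule.span ℝ (u '' (S : Set ι))
      · refine ⟨S, hSs.trans (Finset.subset_insert _ _), hind, ?_, rfl⟩
        intro i hi
        rcases Finset.mem_insert.1 hi with rfl | hi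
        exacts [h, hspan i hi]
      · refine ⟨insert a S, Finset.insert_subset_insert _ hSs, ?_, ?_, ?_⟩
        · rw [Finset.coe_insert]
          exact hind.insert h
        · intro i hi
          rcases Finset.mem_insert.1 hi with rfl | hi
          · exact Submodule.subset_span ⟨i, by simp, rfl⟩
          · refine Submodule.span_mono (Set.image_mono ?_) (hspan i hi)
            simp
        · rw [Finset.sum_insert haS, Finset.card_insert_of_notMem haS]
          push_cast
          ring
    obtain ⟨S', hS's, hind', hspan', hsum⟩ := key
    refine ⟨S', hS's, hind', hspan', fun τ hτ => ?_⟩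
    have h1 := hS (t a) hmin
    have h2 : τ ≤ t a := hτ a (Finset.mem_insert_self _ _)
    have h3 : ((insert a s).card : ℝ) * ρ ≤ S'.card := by
      refine le_trans (mul_le_mul_of_nonneg_right ?_ hρ)
        ((hu (Submodule.span ℝ (u '' (S' : Set ι)))).trans ?_)
      · rw [Nat.card_eq_fintype_card, Fintype.card_subtype]
        exact_mod_cast Finset.card_le_card fun i hi => by simpa using hspan' i hi
      · rw [← Finset.coe_image]
        exact_mod_cast (finrank_span_finset_le_card _).trans Finset.card_image_le
    rw [Finset.sum_insert has]
    rw [Finset.card_insert_of_notMem has] at h3 ⊢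
    push_cast at h3 ⊢
    nlinarith [mul_nonneg (sub_nonneg.2 h2) (sub_nonneg.2 h3)]

theorem Matrix.PosDef.det_add_smul_vecMulVec {κ : Type*} [Fintype κ] [DecidableEq κ]
    {A : Matrix κ κ ℝ} (hA : A.PosDef) (c : ℝ) (x : κ → ℝ) :
    (A + c • vecMulVec x x).det = A.det * (1 + c * (x ⬝ᵥ A⁻¹ *ᵥ x)) := by
  have h := det_add_replicateCol_mul_replicateRow (ι := Unit)
    ((isUnit_iff_isUnit_det A).1 hA.isUnit) (c • x) x
  rw [← vecMulVec_eq, smul_vecMulVec] at h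
  rw [h, det_unique (n := Unit)]
  congr 1
  simp [Matrix.mul_assoc, replicateRow, replicateCol, Matrix.mul_apply, dotProduct, mulVec,
    Finset.mul_sum]
  refine Finset.sum_congr rfl fun i _ => Finset.sum_congr rfl fun j _ => by ring

theorem Matrix.PosDef.det_le_det_add_sum {ι κ : Type*} [Fintype κ] [DecidableEq κ]
    {A : Matrix κ κ ℝ} (hA : A.PosDef) (s : Finset ι) (c : ι → ℝ) (hc : ∀ i, 0 ≤ c i)
    (u : ι → κ → ℝ) :
    (A + ∑ i ∈ s, c i • vecMulVec (u i) (u i)).PosDef ∧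
      A.det ≤ (A + ∑ i ∈ s, c i • vecMulVec (u i) (u i)).det := by
  classical
  induction s using Finset.induction_on with
  | empty => simpa using hA
  | insert a s ha ih =>
    rw [Finset.sum_insert ha, add_comm (c a • _), ← add_assoc]
    have hp : (vecMulVec (u a) (u a)).PosSemidef := by
      simpa using posSemidef_vecMulVec_self_star (u a)
    refine ⟨ih.1.add_posSemidef (hp.smul (hc a)), ih.2.trans ?_⟩
    rw [ih.1.det_add_smul_vecMulVec]
    have h1 := ih.1.inv.posSemidef.dotProduct_mulVec_nonneg (u a)
    rw [star_trivial] at h1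
    nlinarith [ih.1.det_pos, mul_nonneg ih.1.det_pos.le (mul_nonneg (hc a) h1)]

theorem exists_det_lower_bound {ι κ : Type*} [Fintype κ] [DecidableEq κ]
    (u : ι → κ → ℝ) (S : Finset ι) (hcard : S.card = Fintype.card κ)
    (hind : LinearIndepOn ℝ u (S : Set ι)) :
    0 < (∑ i ∈ S, vecMulVec (u i) (u i)).det ∧ ∀ t : ι → ℝ,
      (∑ i ∈ S, Real.exp (t i) • vecMulVec (u i) (u i)).PosDef ∧
      (∑ i ∈ S, Real.exp (t i) • vecMulVec (u i) (u i)).det =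
        Real.exp (∑ i ∈ S, t i) * (∑ i ∈ S, vecMulVec (u i) (u i)).det := by
  have e : κ ≃ S := Fintype.equivOfCardEq (by simp [hcard])
  set M : Matrix κ κ ℝ := Matrix.of fun k => u (e k) with hM
  have hMind : LinearIndependent ℝ M.row := by
    have : LinearIndependent ℝ fun i : (S : Set ι) => u i := hind
    exact this.comp e e.injective
  have hMu : IsUnit M := linearIndependent_rows_iff_isUnit.1 hMind
  have hform : ∀ c : ι → ℝ, ∑ i ∈ S, c i • vecMulVec (u i) (u i) =
      Mᵀ * diagonal (fun k => c (e k)) * M := by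
    intro c
    ext a b
    rw [← Finset.sum_coe_sort S, ← e.sum_comp]
    simp [Matrix.sum_apply, Matrix.mul_apply, vecMulVec_apply, hM, diagonal, mul_assoc, mul_left_comm]
  have hone := hform 1
  simp only [Pi.one_apply, one_smul] at hone
  have hpos : ∀ c : ι → ℝ, (∀ i, 0 < c i) → (∑ i ∈ S, c i • vecMulVec (u i) (u i)).PosDef := by
    intro c hc
    rw [hform]
    have h1 : (diagonal fun k => c (e k)).PosDef := PosDef.diagonal fun k => hc _
    have h2 := h1.conjTranspose_mul_mul_same (B := M) (mulVec_injective_iff_isUnit.2 hMu)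
    simpa using h2
  refine ⟨?_, fun t => ⟨hpos _ fun i => Real.exp_pos _, ?_⟩⟩
  · have := (hpos 1 (by simp)).det_pos
    simpa using this
  · rw [hform, hone, Real.exp_sum, ← Finset.prod_coe_sort S, ← e.prod_comp]
    simp [det_mul, det_diagonal]
    ring

theorem exists_approx_critical {ι κ : Type*} [Fintype ι] [Fintype κ] [DecidableEq κ] [Nonempty ι]
    (u : ι → κ → ℝ) (ρ : ℝ) (hρ : ρ * Fintype.card ι = Fintype.card κ)
    (hu : ∀ X : Submodule ℝ (κ → ℝ), (Nat.card {i // u i ∈ X} : ℝ) * ρ ≤ finrank ℝ X)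
    {η : ℝ} (hη : 0 < η) :
    ∃ t : ι → ℝ, (∑ i, Real.exp (t i) • vecMulVec (u i) (u i)).PosDef ∧
      ∀ i, |Real.exp (t i) * (u i ⬝ᵥ (∑ i, Real.exp (t i) • vecMulVec (u i) (u i))⁻¹ *ᵥ u i) - ρ|
        ≤ η := by
  classical
  set G : (ι → ℝ) → Matrix κ κ ℝ := fun t => ∑ i, Real.exp (t i) • vecMulVec (u i) (u i) with hG
  have hρ0 : 0 ≤ ρ := by
    have : (0 : ℝ) < Fintype.card ι := by exact_mod_cast Fintype.card_pos
    by_contra! h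
    have h2 : (0 : ℝ) ≤ Fintype.card κ := by positivity
    nlinarith
  have hbasis : ∀ t : ι → ℝ, ∃ S : Finset ι, S.card = Fintype.card κ ∧
      LinearIndepOn ℝ u (S : Set ι) ∧ ρ * ∑ i, t i ≤ ∑ i ∈ S, t i := by
    intro t
    obtain ⟨S, -, hind, hspan, hS⟩ := exists_linearIndepOn_weight u ρ hρ0 hu t Finset.univ
    have hcard : S.card = Fintype.card κ := by
      refine le_antisymm ?_ ?_
      · have h1 : Fintype.card (S : Set ι) ≤ finrank ℝ (κ → ℝ) :=
          LinearIndependent.fintype_card_le_finrank (R := ℝ) (b := fun i : (S : Set ι) => u i) hind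
        simpa using h1
      · have h1 := hu (Submodule.span ℝ (u '' (S : Set ι)))
        have h2 : Nat.card {i // u i ∈ Submodule.span ℝ (u '' (S : Set ι))} = Fintype.card ι := by
          rw [Nat.card_eq_fintype_card]
          exact Fintype.card_of_bijective (f := Subtype.val)
            ⟨Subtype.val_injective, fun i => ⟨⟨i, hspan i (Finset.mem_univ i)⟩, rfl⟩⟩
        rw [h2, mul_comm, hρ] at h1
        have h3 : finrank ℝ (Submodule.span ℝ (u '' (S : Set ι))) ≤ S.card := by
          rw [← Finset.coe_image]
          exact (finrank_span_finset_le_card _).trans Finset.card_image_le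
        exact (Nat.cast_le.1 h1).trans h3
    refine ⟨S, hcard, hind, ?_⟩
    obtain ⟨i₀, -, hi₀⟩ := Finset.exists_min_image Finset.univ t Finset.univ_nonempty
    have h := hS (t i₀) hi₀
    rw [hcard, Finset.card_univ, mul_comm _ ρ, hρ] at h
    linarith
  have hposle : ∀ t (S : Finset ι), (∑ i ∈ S, Real.exp (t i) • vecMulVec (u i) (u i)).PosDef →
      (G t).PosDef ∧ (∑ i ∈ S, Real.exp (t i) • vecMulVec (u i) (u i)).det ≤ (G t).det := by
    intro t S hS
    have h := hS.det_le_det_add_sum Sᶜ (fun i => Real.exp (t i)) (fun i => (Real.exp_pos _).le) u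
    rwa [Finset.sum_add_sum_compl] at h
  have hGpos : ∀ t, (G t).PosDef := by
    intro t
    obtain ⟨S, h1, h2, -⟩ := hbasis t
    exact (hposle t S ((exists_det_lower_bound u S h1 h2).2 t).1).1
  obtain ⟨C, hC⟩ : ∃ C : ℝ, ∀ t, C ≤ Real.log (G t).det - ρ * ∑ i, t i := by
    obtain ⟨S₀, -, hS₀⟩ := Finset.exists_min_image
      (Finset.univ : Finset (Finset ι)) (fun S => Real.log (∑ i ∈ S, vecMulVec (u i) (u i)).det)
      Finset.univ_nonempty
    refine ⟨_, fun t => (hS₀ ((hbasis t).choose) (Finset.mem_univ _)).trans ?_⟩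
    obtain ⟨h1, h2, h3⟩ := (hbasis t).choose_spec
    set S := (hbasis t).choose
    obtain ⟨h4, h5⟩ := exists_det_lower_bound u S h1 h2
    have h6 := Real.log_le_log (h5 t).1.det_pos (hposle t S (h5 t).1).2
    rw [(h5 t).2, Real.log_mul (Real.exp_pos _).ne' h4.ne', Real.log_exp] at h6
    linarith
  set K : ℝ := Real.log (G 0).det - C with hK
  have hK0 : 0 ≤ K := by
    have := hC 0
    simp at this
    linarith
  set δ : ℝ := η ^ 2 / (4 * (K + 1)) with hδ
  have hδ0 : 0 < δ := by positivity
  set f : (ι → ℝ) → ℝ := fun t => Real.log (G t).det - ρ * ∑ i, t i + δ * ∑ i, t i ^ 2 with hf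
  have hfcont : Continuous f := by
    have hGc : Continuous fun t => (G t).det := by
      refine Continuous.matrix_det ?_
      simp only [hG]
      fun_prop
    have : Continuous fun t => Real.log (G t).det := hGc.log fun t => (hGpos t).det_pos.ne'
    simp only [hf]
    fun_prop
  have hftop : Filter.Tendsto f (Filter.cocompact _) Filter.atTop := by
    have h1 : Filter.Tendsto (fun t : ι → ℝ => C + δ * ‖t‖ ^ 2) (Filter.cocompact _)
        Filter.atTop := by
      refine Filter.tendsto_atTop_add_const_left _ _ (Filter.Tendsto.const_mul_atTop hδ0 ?_)
      exact (Filter.tendsto_pow_atTop two_ne_zero).comp (tendsto_norm_cocompact_atTop)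
    refine Filter.tendsto_atTop_mono (fun t => ?_) h1
    have h2 : ‖t‖ ^ 2 ≤ ∑ i, t i ^ 2 := by
      have h0 : 0 ≤ ∑ i, t i ^ 2 := Finset.sum_nonneg fun j _ => sq_nonneg _
      rw [← Real.le_sqrt (norm_nonneg _) h0, pi_norm_le_iff_of_nonneg (Real.sqrt_nonneg _)]
      intro i
      exact Real.abs_le_sqrt (Finset.single_le_sum (f := fun i => t i ^ 2)
        (fun j _ => sq_nonneg _) (Finset.mem_univ i))
    have := hC t
    have := mul_le_mul_of_nonneg_left h2 hδ0.le
    simp only [hf]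
    linarith
  obtain ⟨t, ht⟩ := hfcont.exists_forall_le hftop
  refine ⟨t, hGpos t, fun i => ?_⟩
  change |Real.exp (t i) * (u i ⬝ᵥ (G t)⁻¹ *ᵥ u i) - ρ| ≤ η
  set a : ℝ := Real.exp (t i) * (u i ⬝ᵥ (G t)⁻¹ *ᵥ u i) with ha
  have hsmall : δ * t i ^ 2 ≤ K := by
    have h1 := ht 0
    simp only [hf] at h1
    have h2 : t i ^ 2 ≤ ∑ i, t i ^ 2 :=
      Finset.single_le_sum (f := fun i => t i ^ 2) (fun j _ => sq_nonneg _) (Finset.mem_univ i)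
    have h3 := mul_le_mul_of_nonneg_left h2 hδ0.le
    have := hC t
    simp at h1
    linarith
  have hline : ∀ s : ℝ, f (t + Pi.single i s) = Real.log (G t).det +
      Real.log (1 + (Real.exp s - 1) * a) - ρ * (∑ j, t j + s)
        + δ * (∑ j, t j ^ 2 + 2 * t i * s + s ^ 2) := by
    intro s
    have hGs : G (t + Pi.single i s) = G t + ((Real.exp s - 1) * Real.exp (t i)) •
        vecMulVec (u i) (u i) := by
      simp only [hG]
      rw [← Finset.add_sum_erase _ _ (Finset.mem_univ i),
        ← Finset.add_sum_erase Finset.univ (fun j => Real.exp (t j) • _) (Finset.mem_univ i),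
        add_right_comm, ← add_smul]
      congr 1
      · congr 1
        simp [Real.exp_add]
        ring
      · refine Finset.sum_congr rfl fun j hj => ?_
        simp [Finset.ne_of_mem_erase hj]
    have hdet := (hGpos t).det_add_smul_vecMulVec ((Real.exp s - 1) * Real.exp (t i)) (u i)
    rw [← hGs, mul_assoc, ← ha] at hdet
    have hne : 1 + (Real.exp s - 1) * a ≠ 0 := by
      intro h0
      rw [h0, mul_zero] at hdet
      exact (hGpos _).det_pos.ne' hdet
    simp only [hf]
    rw [hdet, Real.log_mul (hGpos t).det_pos.ne' hne]
    have e1 : ∑ j, (t + Pi.single i s : ι → ℝ) j = ∑ j, t j + s := by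
      simp [Finset.sum_add_distrib]
    have e2 : ∑ j, (t + Pi.single i s : ι → ℝ) j ^ 2 = ∑ j, t j ^ 2 + 2 * t i * s + s ^ 2 := by
      rw [← Finset.add_sum_erase _ _ (Finset.mem_univ i),
        ← Finset.add_sum_erase Finset.univ (fun j => t j ^ 2) (Finset.mem_univ i)]
      rw [Finset.sum_congr rfl (g := fun j => t j ^ 2)
        fun j hj => by simp [Finset.ne_of_mem_erase hj]]
      simp
      ring
    rw [e1, e2]
  set g : ℝ → ℝ := fun s => Real.log (G t).det +
      Real.log (1 + (Real.exp s - 1) * a) - ρ * (∑ j, t j + s)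
        + δ * (∑ j, t j ^ 2 + 2 * t i * s + s ^ 2) with hg
  have hder : HasDerivAt g (a - ρ + δ * (2 * t i)) 0 := by
    have h1 : HasDerivAt (fun s : ℝ => 1 + (Real.exp s - 1) * a) a 0 := by
      have := (((Real.hasDerivAt_exp 0).sub_const 1).mul_const a).const_add 1
      simpa using this
    have h2 := h1.log (by simp)
    have h3 : HasDerivAt (fun s : ℝ => ρ * (∑ j, t j + s)) ρ 0 := by
      simpa using ((hasDerivAt_id (0 : ℝ)).const_add (∑ j, t j)).const_mul ρ
    have h4 : HasDerivAt (fun s : ℝ => δ * (∑ j, t j ^ 2 + 2 * t i * s + s ^ 2))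
        (δ * (2 * t i)) 0 := by
      have := ((((hasDerivAt_id (0 : ℝ)).const_mul (2 * t i)).const_add (∑ j, t j ^ 2)).add
        (hasDerivAt_pow 2 (0 : ℝ))).const_mul δ
      simpa using this
    have h5 := ((h2.const_add (Real.log (G t).det)).sub h3).add h4
    rw [Real.exp_zero, sub_self, zero_mul, add_zero, div_one] at h5
    exact h5
  have hmin : IsLocalMin g 0 := by
    refine Filter.Eventually.of_forall fun s => ?_
    have h1 := ht (t + Pi.single i s)
    rw [hline s] at h1
    have h0 := hline 0
    simp only [Pi.single_zero, add_zero] at h0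
    rw [h0] at h1
    simpa [hg] using h1
  have hcrit := hmin.hasDerivAt_eq_zero hder
  have haρ : a - ρ = -(2 * δ * t i) := by linarith
  rw [haρ, abs_neg]
  refine abs_le_of_sq_le_sq ?_ hη.le
  calc (2 * δ * t i) ^ 2 = 4 * δ * (δ * t i ^ 2) := by ring
    _ ≤ 4 * δ * (K + 1) := by gcongr; linarith
    _ = η ^ 2 := by rw [hδ]; field_simp

open scoped MatrixOrder in
/-- Approximate radial isotropic position. -/
theorem exists_isotropic_position {ι κ : Type*} [Fintype ι] [Fintype κ] [DecidableEq κ] [Nonempty ι]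
    (u : ι → κ → ℝ) (ρ : ℝ) (hρ : ρ * Fintype.card ι = Fintype.card κ)
    (hu : ∀ X : Submodule ℝ (κ → ℝ), (Nat.card {i // u i ∈ X} : ℝ) * ρ ≤ finrank ℝ X)
    {η : ℝ} (hη : 0 < η) :
    ∃ (T : Matrix κ κ ℝ) (v : ι → κ → ℝ), IsUnit T ∧ (∀ i, ∃ c : ℝ, v i = c • (T *ᵥ u i)) ∧
      ∑ i, vecMulVec (v i) (v i) = 1 ∧ ∀ i, |v i ⬝ᵥ v i - ρ| ≤ η := by
  obtain ⟨t, hG, ht⟩ := exists_approx_critical u ρ hρ hu hη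
  set G := ∑ i, Real.exp (t i) • vecMulVec (u i) (u i) with hGdef
  obtain ⟨T, hT⟩ : ∃ T : Matrix κ κ ℝ, G⁻¹ = Tᴴ * T :=
    CStarAlgebra.nonneg_iff_eq_star_mul_self.1 hG.inv.posSemidef.nonneg
  have hGu : IsUnit G.det := (isUnit_iff_isUnit_det G).1 hG.isUnit
  rw [conjTranspose_eq_transpose_of_trivial] at hT
  have hTu : IsUnit T.det := by
    have h1 : IsUnit (Tᵀ * T).det := by
      rw [← hT]
      exact (isUnit_iff_isUnit_det _).1 hG.inv.isUnit
    rw [det_mul] at h1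
    exact isUnit_of_mul_isUnit_right h1
  have hexp : ∀ i, Real.exp (t i / 2) * Real.exp (t i / 2) = Real.exp (t i) := fun i => by
    rw [← Real.exp_add, add_halves]
  refine ⟨T, fun i => Real.exp (t i / 2) • (T *ᵥ u i), (isUnit_iff_isUnit_det _).2 hTu,
    fun i => ⟨_, rfl⟩, ?_, fun i => ?_⟩
  · have h1 : ∑ i, vecMulVec (Real.exp (t i / 2) • (T *ᵥ u i)) (Real.exp (t i / 2) • (T *ᵥ u i)) =
        T * G * Tᵀ := by
      rw [hGdef, Finset.mul_sum, Finset.sum_mul]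
      refine Finset.sum_congr rfl fun i _ => ?_
      rw [smul_vecMulVec, vecMulVec_smul, smul_smul, hexp, Matrix.mul_smul, Matrix.smul_mul,
        mul_vecMulVec, vecMulVec_mul, vecMul_transpose]
    rw [h1, Matrix.mul_assoc, mul_eq_one_comm, Matrix.mul_assoc, ← hT, mul_nonsing_inv _ hGu]
  · convert ht i using 3
    rw [hT, ← mulVec_mulVec, dotProduct_mulVec, vecMul_transpose, smul_dotProduct, dotProduct_smul,
      smul_smul, hexp, smul_eq_mul]


theorem sq_trace_le_trace_mul_trace_sq {κ : Type*} [Fintype κ] {S P : Matrix κ κ ℝ}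
    (hS : Sᵀ = S) (hP : Pᵀ = P) (hPP : P * P = P) (hSP : S * P = S) :
    S.trace ^ 2 ≤ P.trace * (S * S).trace := by
  have hPS : P * S = S := by
    rw [← hS, ← hP, ← transpose_mul, hSP]
  have h : ∀ c : ℝ, 0 ≤ P.trace * (c * c) + (-2 * S.trace) * c + (S * S).trace := by
    intro c
    have h1 : 0 ≤ ((S - c • P)ᴴ * (S - c • P)).trace :=
      (posSemidef_conjTranspose_mul_self (S - c • P)).trace_nonneg
    rw [conjTranspose_eq_transpose_of_trivial, transpose_sub, transpose_smul, hS, hP] at h1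
    rw [Matrix.sub_mul, Matrix.mul_sub, Matrix.mul_sub, Matrix.smul_mul, Matrix.smul_mul,
      Matrix.mul_smul, Matrix.mul_smul, hSP, hPS, hPP, smul_smul] at h1
    simp only [trace_sub, trace_smul, smul_eq_mul] at h1
    linarith
  have := discrim_le_zero h
  rw [discrim] at this
  linarith

theorem trace_sum_vecMulVec_mul_self {ι κ : Type*} [Fintype κ] (v : ι → κ → ℝ) (B : Finset ι) :
    ((∑ i ∈ B, vecMulVec (v i) (v i)) * ∑ i ∈ B, vecMulVec (v i) (v i)).trace =
      ∑ i ∈ B, ∑ j ∈ B, (v i ⬝ᵥ v j) ^ 2 := by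
  simp only [Finset.sum_mul, Finset.mul_sum, trace_sum, vecMulVec_mul_vecMulVec, trace_vecMulVec]
  refine Finset.sum_congr rfl fun i _ => Finset.sum_congr rfl fun j _ => ?_
  rw [dotProduct_smul, smul_eq_mul, dotProduct_comm (v j), sq]

theorem sq_sum_dotProduct_le {ι κ : Type*} [Fintype κ] (v : ι → κ → ℝ) (B : Finset ι) :
    (∑ i ∈ B, v i ⬝ᵥ v i) ^ 2 ≤ Fintype.card κ * ∑ i ∈ B, ∑ j ∈ B, (v i ⬝ᵥ v j) ^ 2 := by
  classical
  have h := sq_trace_le_trace_mul_trace_sq (S := ∑ i ∈ B, vecMulVec (v i) (v i))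
    (P := (1 : Matrix κ κ ℝ)) (by simp [transpose_sum, transpose_vecMulVec]) (by simp) (by simp) (by simp)
  rwa [trace_sum_vecMulVec_mul_self, trace_one, trace_sum,
    Finset.sum_congr rfl fun i _ => trace_vecMulVec (v i) (v i)] at h

theorem sq_sum_dotProduct_le_of_orthogonal {ι κ : Type*} [Fintype κ] (v : ι → κ → ℝ)
    (B : Finset ι) {ψ : κ → ℝ} (hψ : ψ ≠ 0) (hB : ∀ i ∈ B, v i ⬝ᵥ ψ = 0) :
    (∑ i ∈ B, v i ⬝ᵥ v i) ^ 2 ≤ (Fintype.card κ - 1) * ∑ i ∈ B, ∑ j ∈ B, (v i ⬝ᵥ v j) ^ 2 := by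
  classical
  have hψ0 : ψ ⬝ᵥ ψ ≠ 0 := by simpa using hψ
  have hSψ : (∑ i ∈ B, vecMulVec (v i) (v i)) * vecMulVec ψ ψ = 0 := by
    rw [Finset.sum_mul]
    refine Finset.sum_eq_zero fun i hi => ?_
    rw [vecMulVec_mul_vecMulVec, hB i hi, zero_smul, vecMulVec_zero]
  have h := sq_trace_le_trace_mul_trace_sq (S := ∑ i ∈ B, vecMulVec (v i) (v i))
    (P := (1 : Matrix κ κ ℝ) - (ψ ⬝ᵥ ψ)⁻¹ • vecMulVec ψ ψ)
    (by simp [transpose_sum, transpose_vecMulVec]) (by simp [transpose_vecMulVec])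
    (by
      simp only [Matrix.sub_mul, Matrix.mul_sub, Matrix.one_mul, Matrix.smul_mul,
        Matrix.mul_smul, vecMulVec_mul_vecMulVec, vecMulVec_smul, smul_smul,
        inv_mul_cancel₀ hψ0, mul_one]
      simp)
    (by rw [Matrix.mul_sub, Matrix.mul_smul, hSψ, smul_zero, sub_zero, Matrix.mul_one])
  rw [trace_sum_vecMulVec_mul_self, trace_sub, trace_smul, trace_one, trace_vecMulVec, smul_eq_mul,
    inv_mul_cancel₀ hψ0, trace_sum,
    Finset.sum_congr rfl fun i _ => trace_vecMulVec (v i) (v i)] at h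
  exact h

theorem sum_blocks_eq {ι α : Type*} [Fintype ι] [DecidableEq ι] (X : Finset α) (B : α → Finset ι)
    (F : ι → ι → ℝ) :
    ∑ x ∈ X, ∑ i ∈ B x, ∑ j ∈ B x, F i j =
      ∑ i, ∑ j, ((X.filter fun x => i ∈ B x ∧ j ∈ B x).card : ℝ) * F i j := by
  have h1 : ∀ x ∈ X, ∑ i ∈ B x, ∑ j ∈ B x, F i j =
      ∑ i, ∑ j, if i ∈ B x ∧ j ∈ B x then F i j else 0 := by
    intro x _
    simp [ite_and, Finset.sum_ite_mem]
  rw [Finset.sum_congr rfl h1, Finset.sum_comm]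
  refine Finset.sum_congr rfl fun i _ => ?_
  rw [Finset.sum_comm]
  refine Finset.sum_congr rfl fun j _ => ?_
  rw [← Finset.sum_filter, Finset.sum_const, nsmul_eq_mul]

theorem card_exceptional_pairs_le {ι κ α : Type*} [Fintype ι] [DecidableEq ι] [Nonempty ι]
    [Fintype κ] [DecidableEq κ] (v : ι → κ → ℝ) (hv : ∑ i, vecMulVec (v i) (v i) = 1)
    (hnorm : ∀ i, |v i ⬝ᵥ v i - Fintype.card κ / Fintype.card ι| ≤
      Fintype.card κ / (2 * Fintype.card ι))
    (hκ : 0 < Fintype.card κ)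
    (X X₁ : Finset α) (hX₁ : X₁ ⊆ X) (B : α → Finset ι)
    (hB : ∀ i j, i ≠ j → (X.filter fun x => i ∈ B x ∧ j ∈ B x).card ≤ 1)
    (R : ℝ) (hR : ∀ i, ((X.filter fun x => i ∈ B x).card : ℝ) ≤ R)
    (hψ : ∀ x ∈ X₁, ∃ ψ : κ → ℝ, ψ ≠ 0 ∧ ∀ i ∈ B x, v i ⬝ᵥ ψ = 0)
    (Bad E : Finset (ι × ι)) (hBad : ∀ i j, (i, j) ∉ Bad → ∃ x ∈ X, i ∈ B x ∧ j ∈ B x)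
    (hE : ∀ i j, (i, j) ∈ E → ∃ x ∈ X₁, i ∈ B x ∧ j ∈ B x) :
    (E.card : ℝ) ≤ 16 * (Fintype.card κ : ℝ) ^ 2 * R * Fintype.card ι +
      16 * Fintype.card κ * Bad.card := by
  set w := (Fintype.card κ : ℝ) with hw
  set D := (Fintype.card ι : ℝ) with hD
  have hw0 : 0 < w := by rw [hw]; exact_mod_cast hκ
  have hD0 : 0 < D := by rw [hD]; exact_mod_cast Fintype.card_pos
  set a : ι → ℝ := fun i => v i ⬝ᵥ v i with ha
  have hR0 : 0 ≤ R := (Nat.cast_nonneg _).trans (hR (Classical.arbitrary ι))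
  have hwD : w / D = 2 * (w / (2 * D)) := by field_simp
  set q : ℝ := w / (2 * D) with hq
  have hq0 : 0 < q := by positivity
  have ha1 : ∀ i, q ≤ a i := fun i => by
    have := (abs_le.1 (hnorm i)).1
    linarith
  have ha2 : ∀ i, a i ≤ 4 * q := fun i => by
    have := (abs_le.1 (hnorm i)).2
    linarith
  have ha0 : ∀ i, 0 ≤ a i := fun i => hq0.le.trans (ha1 i)
  have hsum : ∑ i, a i = w := by
    have := congrArg trace hv
    rwa [trace_sum, trace_one, Finset.sum_congr rfl fun i _ => trace_vecMulVec (v i) (v i)] at this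
  have hsq : ∑ i, ∑ j, (v i ⬝ᵥ v j) ^ 2 = w := by
    rw [← trace_sum_vecMulVec_mul_self, hv, Matrix.mul_one, trace_one]
  have hQ : ∑ x ∈ X, ∑ i ∈ B x, ∑ j ∈ B x, (v i ⬝ᵥ v j) ^ 2 ≤ w + R * D * (4 * q) ^ 2 := by
    rw [sum_blocks_eq]
    calc _ ≤ ∑ i, (∑ j, (v i ⬝ᵥ v j) ^ 2 + R * (4 * q) ^ 2) := by
          refine Finset.sum_le_sum fun i _ => ?_
          rw [← Finset.add_sum_erase _ _ (Finset.mem_univ i)]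
          have h1 : ∑ j ∈ Finset.univ.erase i,
              ((X.filter fun x => i ∈ B x ∧ j ∈ B x).card : ℝ) * (v i ⬝ᵥ v j) ^ 2 ≤
              ∑ j, (v i ⬝ᵥ v j) ^ 2 := by
            refine (Finset.sum_le_sum (g := fun j => (v i ⬝ᵥ v j) ^ 2) fun j hj => ?_).trans
              (Finset.sum_le_sum_of_subset_of_nonneg (Finset.erase_subset _ _)
                fun j _ _ => sq_nonneg _)
            have h2 : ((X.filter fun x => i ∈ B x ∧ j ∈ B x).card : ℝ) ≤ 1 := by
              exact_mod_cast hB i j (Finset.ne_of_mem_erase hj).symm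
            nlinarith [sq_nonneg (v i ⬝ᵥ v j)]
          have h3 : ((X.filter fun x => i ∈ B x ∧ i ∈ B x).card : ℝ) * (v i ⬝ᵥ v i) ^ 2 ≤
              R * (4 * q) ^ 2 := by
            have := hR i
            simp only [and_self]
            gcongr
            · exact ha0 i
            · exact ha2 i
          linarith
      _ = _ := by
          rw [Finset.sum_add_distrib, hsq, Finset.sum_const, Finset.card_univ, nsmul_eq_mul]
          ring
  have hA : w ^ 2 - Bad.card * (4 * q) ^ 2 ≤ ∑ x ∈ X, (∑ i ∈ B x, a i) ^ 2 := by
    have h1 : ∑ x ∈ X, (∑ i ∈ B x, a i) ^ 2 = ∑ x ∈ X, ∑ i ∈ B x, ∑ j ∈ B x, a i * a j :=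
      Finset.sum_congr rfl fun x _ => by rw [sq, Finset.sum_mul_sum]
    have h2 : w ^ 2 = ∑ p : ι × ι, a p.1 * a p.2 := by
      rw [← hsum, sq, Finset.sum_mul_sum, Fintype.sum_prod_type]
    have h3 : ∑ p ∈ Bad, a p.1 * a p.2 ≤ Bad.card * (4 * q) ^ 2 := by
      rw [← nsmul_eq_mul]
      refine Finset.sum_le_card_nsmul _ _ _ fun p _ => ?_
      rw [sq]
      exact mul_le_mul (ha2 _) (ha2 _) (ha0 _) (by positivity)
    rw [h1, sum_blocks_eq, h2, ← Finset.sum_add_sum_compl Bad,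
      ← Fintype.sum_prod_type' (f := fun i j => _ * (a i * a j)),
      ← Finset.sum_add_sum_compl Bad (fun p : ι × ι => _ * (a p.1 * a p.2))]
    have h4 : ∑ p ∈ Badᶜ, a p.1 * a p.2 ≤ ∑ p ∈ Badᶜ,
        ((X.filter fun x => p.1 ∈ B x ∧ p.2 ∈ B x).card : ℝ) * (a p.1 * a p.2) := by
      refine Finset.sum_le_sum fun p hp => ?_
      obtain ⟨x, hx, hxp⟩ := hBad p.1 p.2 (Finset.mem_compl.1 hp)
      have h5 : (1 : ℝ) ≤ (X.filter fun x => p.1 ∈ B x ∧ p.2 ∈ B x).card := by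
        exact_mod_cast Finset.card_pos.2 ⟨x, Finset.mem_filter.2 ⟨hx, hxp⟩⟩
      nlinarith [mul_nonneg (ha0 p.1) (ha0 p.2)]
    have h6 : 0 ≤ ∑ p ∈ Bad,
        ((X.filter fun x => p.1 ∈ B x ∧ p.2 ∈ B x).card : ℝ) * (a p.1 * a p.2) :=
      Finset.sum_nonneg fun p _ => mul_nonneg (Nat.cast_nonneg _) (mul_nonneg (ha0 _) (ha0 _))
    linarith
  have hE1 : E.card * q ^ 2 ≤ ∑ x ∈ X₁, (∑ i ∈ B x, a i) ^ 2 := by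
    have h1 : ∑ x ∈ X₁, (∑ i ∈ B x, a i) ^ 2 = ∑ x ∈ X₁, ∑ i ∈ B x, ∑ j ∈ B x, a i * a j :=
      Finset.sum_congr rfl fun x _ => by rw [sq, Finset.sum_mul_sum]
    rw [h1, sum_blocks_eq, ← Fintype.sum_prod_type' (f := fun i j => _ * (a i * a j)),
      ← nsmul_eq_mul]
    refine (Finset.card_nsmul_le_sum E (fun p : ι × ι =>
      ((X₁.filter fun x => p.1 ∈ B x ∧ p.2 ∈ B x).card : ℝ) * (a p.1 * a p.2)) _
        fun p hp => ?_).trans (Finset.sum_le_sum_of_subset_of_nonneg (Finset.subset_univ _)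
        fun p _ _ => mul_nonneg (Nat.cast_nonneg _) (mul_nonneg (ha0 _) (ha0 _)))
    obtain ⟨x, hx, hxp⟩ := hE p.1 p.2 hp
    have h5 : (1 : ℝ) ≤ (X₁.filter fun x => p.1 ∈ B x ∧ p.2 ∈ B x).card := by
      exact_mod_cast Finset.card_pos.2 ⟨x, Finset.mem_filter.2 ⟨hx, hxp⟩⟩
    have h6 : q ^ 2 ≤ a p.1 * a p.2 := by
      rw [sq]
      exact mul_le_mul (ha1 _) (ha1 _) hq0.le (ha0 _)
    nlinarith [mul_nonneg (ha0 p.1) (ha0 p.2)]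
  have hmain : w * ∑ x ∈ X, (∑ i ∈ B x, a i) ^ 2 + ∑ x ∈ X₁, (∑ i ∈ B x, a i) ^ 2 ≤
      w ^ 2 * ∑ x ∈ X, ∑ i ∈ B x, ∑ j ∈ B x, (v i ⬝ᵥ v j) ^ 2 := by
    classical
    rw [← Finset.sum_sdiff hX₁, ← Finset.sum_sdiff hX₁ (f := fun x => ∑ i ∈ B x, ∑ j ∈ B x, _),
      mul_add, mul_add, add_assoc, Finset.mul_sum, Finset.mul_sum, Finset.mul_sum, Finset.mul_sum,
      ← Finset.sum_add_distrib]
    refine add_le_add (Finset.sum_le_sum fun x _ => ?_) (Finset.sum_le_sum fun x hx => ?_)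
    · have := mul_le_mul_of_nonneg_left (sq_sum_dotProduct_le v (B x)) hw0.le
      rw [← hw] at this
      linarith
    · obtain ⟨ψ, hψ0, hψB⟩ := hψ x hx
      have := mul_le_mul_of_nonneg_left (sq_sum_dotProduct_le_of_orthogonal v (B x) hψ0 hψB)
        (by positivity : 0 ≤ w + 1)
      rw [← hw] at this
      have h7 : 0 ≤ ∑ i ∈ B x, ∑ j ∈ B x, (v i ⬝ᵥ v j) ^ 2 :=
        Finset.sum_nonneg fun _ _ => Finset.sum_nonneg fun _ _ => sq_nonneg _
      linarith
  have hfin : E.card * q ^ 2 ≤ w ^ 2 * (R * D * (4 * q) ^ 2) + w * (Bad.card * (4 * q) ^ 2) := by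
    have h1 := mul_le_mul_of_nonneg_left hQ (sq_nonneg w)
    have h2 := mul_le_mul_of_nonneg_left hA hw0.le
    linarith
  have hq2 : 0 < q ^ 2 := by positivity
  refine le_of_mul_le_mul_right ?_ hq2
  linarith

theorem exists_max_slope {V : Type*} [AddCommGroup V] [Module ℝ V] [FiniteDimensional ℝ V]
    {ι : Type*} (I : Finset ι) (u : ι → V) (Z : Submodule ℝ V) (hZ : Z ≠ ⊥)
    [∀ W : Submodule ℝ V, DecidablePred fun i => u i ∈ W] :
    ∃ W ≤ Z, W ≠ ⊥ ∧ ∀ Y ≤ Z, Y ≠ ⊥ →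
      (I.filter fun i => u i ∈ Y).card * finrank ℝ W ≤
        (I.filter fun i => u i ∈ W).card * finrank ℝ Y := by
  set f : Submodule ℝ V → ℕ × ℕ := fun W => ((I.filter fun i => u i ∈ W).card, finrank ℝ W)
  set s : Set (ℕ × ℕ) := f '' {W | W ≤ Z ∧ W ≠ ⊥}
  have hs : s.Finite := by
    refine ((Set.finite_Iic I.card).prod (Set.finite_Iic (finrank ℝ V))).subset ?_
    rintro _ ⟨W, -, rfl⟩
    exact ⟨Finset.card_filter_le _ _, Submodule.finrank_le W⟩
  obtain ⟨_, ⟨W, ⟨hWZ, hW⟩, rfl⟩, hmax⟩ :=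
    Set.exists_max_image s (fun p => (p.1 : ℝ) / p.2) hs ⟨_, Z, ⟨le_rfl, hZ⟩, rfl⟩
  refine ⟨W, hWZ, hW, fun Y hYZ hY => ?_⟩
  have h := hmax _ ⟨Y, ⟨hYZ, hY⟩, rfl⟩
  have h1 : 0 < finrank ℝ W := Nat.pos_of_ne_zero fun h => hW (Submodule.finrank_eq_zero.1 h)
  have h2 : 0 < finrank ℝ Y := Nat.pos_of_ne_zero fun h => hY (Submodule.finrank_eq_zero.1 h)
  rw [div_le_div_iff₀ (by exact_mod_cast h2) (by exact_mod_cast h1)] at h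
  exact_mod_cast h

theorem exists_ne_zero_mem_orthogonal {V : Type*} [NormedAddCommGroup V] [InnerProductSpace ℝ V]
    [FiniteDimensional ℝ V] {E Z : Submodule ℝ V} (h : ¬ Z ≤ E) :
    ∃ x ∈ Z, x ≠ 0 ∧ ∀ z ∈ E ⊓ Z, inner ℝ x z = 0 := by
  have h1 := Submodule.sup_orthogonal_inf_of_hasOrthogonalProjection
    (inf_le_right : E ⊓ Z ≤ Z)
  have h2 : (E ⊓ Z)ᗮ ⊓ Z ≠ ⊥ := by
    intro h0
    rw [h0, sup_bot_eq] at h1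
    exact h (inf_eq_right.1 h1)
  obtain ⟨x, hx, hx0⟩ := Submodule.exists_mem_ne_zero_of_ne_bot h2
  exact ⟨x, hx.2, hx0, fun z hz => (Submodule.mem_orthogonal' _ _).1 hx.1 z hz⟩

/-- The subspaces `E i` and `E j`, of different indices, meet nontrivially and inside `Z`. -/
def MeetsIn {V ι : Type*} [AddCommGroup V] [Module ℝ V] (E : ι → Submodule ℝ V)
    (Z : Submodule ℝ V) (i j : ι) : Prop :=
  i ≠ j ∧ E i ⊓ E j ≠ ⊥ ∧ E i ⊓ E j ≤ Z

theorem eq_inf_of_le {V : Type*} [AddCommGroup V] [Module ℝ V] [FiniteDimensional ℝ V]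
    {E F x : Submodule ℝ V} (h : finrank ℝ (E ⊓ F : Submodule ℝ V) ≤ 1) (hx : x ≠ ⊥)
    (hE : x ≤ E) (hF : x ≤ F) : x = E ⊓ F := by
  refine Submodule.eq_of_le_of_finrank_le (le_inf hE hF) (h.trans ?_)
  exact Nat.one_le_iff_ne_zero.2 fun h => hx (Submodule.finrank_eq_zero.1 h)

open Classical in
theorem exists_smaller_subspace {V : Type*} [NormedAddCommGroup V] [InnerProductSpace ℝ V]
    [FiniteDimensional ℝ V] {ι : Type*} (E : ι → Submodule ℝ V) (I : Finset ι)
    (hI : I.Nonempty)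
    (hE : ∀ i ∈ I, ∀ j ∈ I, i ≠ j → finrank ℝ (E i ⊓ E j : Submodule ℝ V) ≤ 1)
    (Z : Submodule ℝ V) (hZ : Z ≠ ⊥) (hZE : ∀ i ∈ I, ¬ Z ≤ E i) (R : ℝ)
    (hR : ∀ i ∈ I, (((I.erase i).image fun j => E i ⊓ E j).card : ℝ) ≤ R) :
    ∃ J ⊆ I, ∃ Z' < Z, I.card ≤ finrank ℝ Z * J.card ∧
      (((J ×ˢ J).filter fun p => ¬ MeetsIn E Z' p.1 p.2).card : ℝ) ≤
        16 * (finrank ℝ Z : ℝ) ^ 2 * R * J.card +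
          17 * finrank ℝ Z * ((I ×ˢ I).filter fun p => ¬ MeetsIn E Z p.1 p.2).card := by
  have hu : ∀ i, ∃ x : V, i ∈ I → (x ∈ Z ∧ x ≠ 0 ∧ ∀ z ∈ E i ⊓ Z, inner ℝ x z = 0) := by
    intro i
    by_cases hi : i ∈ I
    · obtain ⟨x, h⟩ := exists_ne_zero_mem_orthogonal (hZE i hi)
      exact ⟨x, fun _ => h⟩
    · exact ⟨0, fun h => absurd h hi⟩
  choose u hu using hu
  obtain ⟨W, hWZ, hW, hmax⟩ := exists_max_slope I u Z hZ
  set J := I.filter fun i => u i ∈ W with hJ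
  have hJI : J ⊆ I := Finset.filter_subset _ _
  set w := finrank ℝ W with hw
  have hw1 : 1 ≤ w := Nat.one_le_iff_ne_zero.2 fun h => hW (Submodule.finrank_eq_zero.1 h)
  have hwZ : w ≤ finrank ℝ Z := Submodule.finrank_mono hWZ
  have hcard : I.card * w ≤ J.card * finrank ℝ Z := by
    have h := hmax Z le_rfl hZ
    rwa [Finset.filter_true_of_mem fun i hi => (hu i hi).1] at h
  have hJpos : 0 < J.card := by
    by_contra! h0
    have := hI.card_pos
    nlinarith
  have : Nonempty J := (Finset.card_pos.1 hJpos).to_subtype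
  have hJW : ∀ i : J, u i ∈ W := fun i => (Finset.mem_filter.1 i.2).2
  have hJmem : ∀ i : J, (i : ι) ∈ I := fun i => hJI i.2
  refine ⟨J, hJI, Wᗮ ⊓ Z, ?_, ?_, ?_⟩
  · refine lt_of_le_of_ne inf_le_right fun h => ?_
    obtain ⟨x, hx, hx0⟩ := Submodule.exists_mem_ne_zero_of_ne_bot hW
    have h1 : x ∈ Wᗮ := inf_eq_right.1 h (hWZ hx)
    exact hx0 (inner_self_eq_zero.1 ((Submodule.mem_orthogonal _ _).1 h1 x hx))
  · calc I.card ≤ I.card * w := Nat.le_mul_of_pos_right _ hw1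
      _ ≤ _ := hcard
      _ = _ := mul_comm _ _
  set b := finBasis ℝ W
  set u' : J → Fin w → ℝ := fun i => b.equivFun ⟨u i, hJW i⟩ with hu'
  set ρ : ℝ := (w : ℝ) / J.card with hρ
  have hJ0 : (0 : ℝ) < J.card := by exact_mod_cast hJpos
  have hw0 : (0 : ℝ) < w := by exact_mod_cast hw1
  have hstable : ∀ X : Submodule ℝ (Fin w → ℝ),
      (Nat.card {i // u' i ∈ X} : ℝ) * ρ ≤ finrank ℝ X := by
    intro X
    set Y : Submodule ℝ V := (X.map (b.equivFun.symm : (Fin w → ℝ) →ₗ[ℝ] W)).map W.subtype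
      with hY
    have hYdim : finrank ℝ Y = finrank ℝ X := by
      rw [hY, Submodule.finrank_map_subtype_eq,
        LinearEquiv.finrank_map_eq]
    have hYW : Y ≤ W := Submodule.map_subtype_le _ _
    have hmem : ∀ i : J, u' i ∈ X → u i ∈ Y := by
      intro i hi
      exact ⟨⟨u i, hJW i⟩, ⟨u' i, hi, by simp [hu']⟩, rfl⟩
    have hle : Nat.card {i // u' i ∈ X} ≤ (I.filter fun i => u i ∈ Y).card := by
      rw [Nat.card_eq_fintype_card, ← Fintype.card_coe]
      refine Fintype.card_le_of_injective
        (fun i => ⟨i.1.1, Finset.mem_filter.2 ⟨hJmem i.1, hmem _ i.2⟩⟩) fun i j hij => ?_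
      exact Subtype.ext (Subtype.ext (Subtype.mk.inj hij))
    have hYcard : (I.filter fun i => u i ∈ Y).card * w ≤ J.card * finrank ℝ Y := by
      by_cases hYbot : Y = ⊥
      · have : (I.filter fun i => u i ∈ Y) = ∅ := by
          refine Finset.filter_false_of_mem fun i hi h => (hu i hi).2.1 ?_
          rwa [hYbot, Submodule.mem_bot] at h
        simp [this]
      · exact hmax Y (hYW.trans hWZ) hYbot
    rw [hρ, ← hYdim, mul_div_assoc', div_le_iff₀ hJ0, mul_comm (finrank ℝ Y : ℝ)]
    exact_mod_cast (Nat.mul_le_mul_right w hle).trans hYcard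
  obtain ⟨T, v, hT, hvT, hv1, hvρ⟩ := exists_isotropic_position u' ρ
    (by rw [hρ, Fintype.card_coe, Fintype.card_fin]; field_simp) hstable
    (η := ρ / 2) (by positivity)
  set X : Finset (Submodule ℝ V) :=
    ((J ×ˢ J).filter fun p => MeetsIn E Z p.1 p.2).image fun p => E p.1 ⊓ E p.2 with hX
  have hXmem : ∀ x ∈ X, x ≠ ⊥ ∧ x ≤ Z ∧ ∃ i ∈ J, ∃ j ∈ J, i ≠ j ∧ x = E i ⊓ E j := by
    intro x hx
    obtain ⟨⟨i, j⟩, hp, rfl⟩ := Finset.mem_image.1 hx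
    obtain ⟨hp, hm⟩ := Finset.mem_filter.1 hp
    obtain ⟨hi, hj⟩ := Finset.mem_product.1 hp
    exact ⟨hm.2.1, hm.2.2, i, hi, j, hj, hm.1, rfl⟩
  set B : Submodule ℝ V → Finset J := fun x => Finset.univ.filter fun i => x ≤ E i with hBdef
  set Bad : Finset (J × J) := Finset.univ.filter fun p => ¬ MeetsIn E Z p.1 p.2 with hBad
  set Exc : Finset (J × J) := Finset.univ.filter fun p => MeetsIn E Z p.1 p.2 ∧
    ¬ E p.1 ⊓ E p.2 ≤ Wᗮ with hExc
  have hXof : ∀ i j : J, MeetsIn E Z i j → E i ⊓ E j ∈ X := fun i j h =>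
    Finset.mem_image.2 ⟨(i, j), Finset.mem_filter.2 ⟨Finset.mem_product.2 ⟨i.2, j.2⟩, h⟩, rfl⟩
  have hmain := card_exceptional_pairs_le v hv1
    (by
      intro i
      rw [Fintype.card_fin, Fintype.card_coe]
      convert hvρ i using 1
      rw [hρ]
      field_simp)
    (by rw [Fintype.card_fin]; exact hw1) X (X.filter fun x => ¬ x ≤ Wᗮ)
    (Finset.filter_subset _ _) B
    (by
      intro i j hij
      refine Finset.card_le_one.2 fun x hx y hy => ?_
      simp only [Finset.mem_filter, hBdef, Finset.mem_univ, true_and] at hx hy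
      have hfr := hE i (hJmem i) j (hJmem j) fun h => hij (Subtype.ext h)
      rw [eq_inf_of_le hfr (hXmem x hx.1).1 hx.2.1 hx.2.2,
        eq_inf_of_le hfr (hXmem y hy.1).1 hy.2.1 hy.2.2])
    R
    (by
      intro i
      refine le_trans ?_ (hR i (hJmem i))
      refine Nat.cast_le.2 (Finset.card_le_card fun x hx => ?_)
      simp only [Finset.mem_filter, hBdef, Finset.mem_univ, true_and] at hx
      obtain ⟨hx0, -, j, hj, k, hk, hjk, hxjk⟩ := hXmem x hx.1
      have hother : ∃ l ∈ I, l ≠ i ∧ x ≤ E l := by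
        by_cases hji : j = i
        · exact ⟨k, hJI hk, fun h => hjk (hji.trans h.symm), hxjk.le.trans inf_le_right⟩
        · exact ⟨j, hJI hj, hji, hxjk.le.trans inf_le_left⟩
      obtain ⟨l, hl, hli, hxl⟩ := hother
      exact Finset.mem_image.2 ⟨l, Finset.mem_erase.2 ⟨hli, hl⟩,
        (eq_inf_of_le (hE i (hJmem i) l hl hli.symm) hx0 hx.2 hxl).symm⟩)
    (by
      intro x hx
      obtain ⟨hx, hxW⟩ := Finset.mem_filter.1 hx
      obtain ⟨z, hzx, hzW⟩ := SetLike.not_le_iff_exists.1 hxW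
      set φ : Fin w → ℝ := fun k => inner ℝ (b k : V) z with hφ
      have hφu : ∀ y : W, b.equivFun y ⬝ᵥ φ = inner ℝ (y : V) z := by
        intro y
        have h : inner ℝ (y : V) z = inner ℝ ((∑ k, b.equivFun y k • b k : W) : V) z := by
          rw [b.sum_equivFun]
        rw [h, Submodule.coe_sum, sum_inner]
        refine Finset.sum_congr rfl fun k _ => ?_
        rw [Submodule.coe_smul, real_inner_smul_left]
      have hTdet : IsUnit T.det := (isUnit_iff_isUnit_det T).1 hT
      refine ⟨φ ᵥ* T⁻¹, fun h0 => ?_, fun i hi => ?_⟩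
      · have hφ0 : φ = 0 := by
          have := congrArg (fun y => y ᵥ* T) h0
          simpa [vecMul_vecMul, nonsing_inv_mul _ hTdet] using this
        refine hzW ((Submodule.mem_orthogonal _ _).2 fun y hy => ?_)
        have := hφu ⟨y, hy⟩
        rw [hφ0, dotProduct_zero] at this
        exact this.symm
      · obtain ⟨c, hc⟩ := hvT i
        have hxi : x ≤ E i := (Finset.mem_filter.1 hi).2
        rw [hc, dotProduct_comm, ← dotProduct_mulVec, mulVec_smul, mulVec_mulVec,
          nonsing_inv_mul _ hTdet, one_mulVec, dotProduct_smul, dotProduct_comm, hφu,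
          (hu i (hJmem i)).2.2 z ⟨hxi hzx, (hXmem x hx).2.1 hzx⟩, smul_zero])
    Bad Exc
    (by
      intro i j hij
      have h : MeetsIn E Z i j := by simpa [hBad] using hij
      exact ⟨_, hXof i j h, by simp [hBdef], by simp [hBdef]⟩)
    (by
      intro i j hij
      have h : MeetsIn E Z i j ∧ ¬ E i ⊓ E j ≤ Wᗮ := by simpa [hExc] using hij
      exact ⟨_, Finset.mem_filter.2 ⟨hXof i j h.1, h.2⟩, by simp [hBdef], by simp [hBdef]⟩)
  have hinj : Function.Injective fun p : J × J => ((p.1 : ι), (p.2 : ι)) := fun p q h =>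
    Prod.ext (Subtype.ext (congrArg Prod.fst h)) (Subtype.ext (congrArg Prod.snd h))
  have hBadle : Bad.card ≤ ((I ×ˢ I).filter fun p => ¬ MeetsIn E Z p.1 p.2).card := by
    rw [← Finset.card_image_of_injective _ hinj]
    refine Finset.card_le_card fun q hq => ?_
    obtain ⟨p, hp, rfl⟩ := Finset.mem_image.1 hq
    exact Finset.mem_filter.2 ⟨Finset.mem_product.2 ⟨hJmem _, hJmem _⟩,
      (Finset.mem_filter.1 hp).2⟩
  have hcover : ((J ×ˢ J).filter fun p => ¬ MeetsIn E (Wᗮ ⊓ Z) p.1 p.2).card ≤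
      Exc.card + Bad.card := by
    refine le_trans ?_ (Finset.card_union_le Exc Bad)
    rw [← Finset.card_image_of_injective _ hinj]
    refine Finset.card_le_card fun q hq => ?_
    obtain ⟨hq, hqm⟩ := Finset.mem_filter.1 hq
    obtain ⟨h1, h2⟩ := Finset.mem_product.1 hq
    refine Finset.mem_image.2 ⟨(⟨q.1, h1⟩, ⟨q.2, h2⟩), ?_, rfl⟩
    simp only [hExc, hBad, Finset.mem_union, Finset.mem_filter, Finset.mem_univ, true_and]
    by_cases hm : MeetsIn E Z q.1 q.2
    · exact Or.inl ⟨hm, fun h => hqm ⟨hm.1, hm.2.1, le_inf h hm.2.2⟩⟩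
    · exact Or.inr hm
  rw [Fintype.card_fin, Fintype.card_coe] at hmain
  have hR0 : 0 ≤ R := (Nat.cast_nonneg _).trans (hR _ hI.choose_spec)
  have hwZ' : (w : ℝ) ≤ finrank ℝ Z := by exact_mod_cast hwZ
  have hZ1 : (1 : ℝ) ≤ finrank ℝ Z := by exact_mod_cast hw1.trans hwZ
  set b₀ : ℝ := (((I ×ˢ I).filter fun p => ¬ MeetsIn E Z p.1 p.2).card : ℝ) with hb₀
  have hBadle' : (Bad.card : ℝ) ≤ b₀ := Nat.cast_le.2 hBadle
  have hcover' : (((J ×ˢ J).filter fun p => ¬ MeetsIn E (Wᗮ ⊓ Z) p.1 p.2).card : ℝ) ≤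
      Exc.card + Bad.card := by exact_mod_cast hcover
  have hb0 : (0 : ℝ) ≤ Bad.card := Nat.cast_nonneg _
  calc _ ≤ (Exc.card + Bad.card : ℝ) := hcover'
    _ ≤ 16 * (w : ℝ) ^ 2 * R * J.card + 16 * w * Bad.card + 1 * Bad.card := by linarith
    _ ≤ 16 * (finrank ℝ Z : ℝ) ^ 2 * R * J.card + 16 * finrank ℝ Z * b₀ + finrank ℝ Z * b₀ := by
        gcongr
    _ = _ := by ring

open Classical in
theorem exists_popular_line (V ι : Type*) [NormedAddCommGroup V] [InnerProductSpace ℝ V]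
    [FiniteDimensional ℝ V] (N : ℕ) :
    ∃ η δ c : ℝ, 0 < η ∧ 0 < δ ∧ 0 < c ∧ ∀ (E : ι → Submodule ℝ V) (I : Finset ι), I.Nonempty →
      (∀ i ∈ I, ∀ j ∈ I, i ≠ j → finrank ℝ (E i ⊓ E j : Submodule ℝ V) ≤ 1) →
      ∀ Z : Submodule ℝ V, finrank ℝ Z ≤ N →
      (((I ×ˢ I).filter fun p => ¬ MeetsIn E Z p.1 p.2).card : ℝ) ≤ η * (I.card : ℝ) ^ 2 →
      (∀ i ∈ I, (((I.erase i).image fun j => E i ⊓ E j).card : ℝ) ≤ δ * I.card) →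
      ∃ x : Submodule ℝ V, finrank ℝ x = 1 ∧
        c * I.card ≤ ((I.filter fun i => x ≤ E i).card : ℝ) := by
  have hbot : ∀ (E : ι → Submodule ℝ V) (I : Finset ι), I.Nonempty →
      ¬ (((I ×ˢ I).filter fun p => ¬ MeetsIn E ⊥ p.1 p.2).card : ℝ) ≤
        1 / 2 * (I.card : ℝ) ^ 2 := by
    intro E I hI h
    rw [Finset.filter_true_of_mem fun p _ hp => hp.2.1 (le_bot_iff.1 hp.2.2),
      Finset.card_product] at h
    have : (0 : ℝ) < I.card := by exact_mod_cast hI.card_pos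
    push_cast at h
    nlinarith
  induction N with
  | zero =>
    refine ⟨1 / 2, 1, 1, by norm_num, by norm_num, by norm_num, ?_⟩
    intro E I hI _ Z hZ hbad
    rw [Submodule.finrank_eq_zero.1 (Nat.le_zero.1 hZ)] at hbad
    exact absurd hbad (hbot E I hI)
  | succ N ih =>
    obtain ⟨η, δ, c, hη, hδ, hc, ih⟩ := ih
    set M : ℝ := N + 1 with hM
    have hM0 : 0 < M := by positivity
    refine ⟨min (η / (136 * M ^ 3)) (1 / 4), min (η / (64 * M ^ 3)) (δ / (2 * M)),
      min (c / (2 * M)) (1 / 2), by positivity, by positivity, by positivity, ?_⟩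
    intro E I hI hE Z hZ hbad hR
    have hn : (0 : ℝ) < I.card := by exact_mod_cast hI.card_pos
    have hbad1 := hbad.trans (mul_le_mul_of_nonneg_right (min_le_right _ _) (sq_nonneg _))
    have hZM : (finrank ℝ Z : ℝ) ≤ M := by rw [hM]; exact_mod_cast hZ
    have hZbot : Z ≠ ⊥ := by
      rintro rfl
      exact hbot E I hI (hbad1.trans (by gcongr; norm_num))
    by_cases hA : (I.card : ℝ) / 2 ≤ (I.filter fun i => Z ≤ E i).card
    · refine ⟨Z, ?_, ?_⟩
      · have hdiag : I.card ≤ ((I ×ˢ I).filter fun p => ¬ MeetsIn E Z p.1 p.2).card := by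
          rw [← Finset.card_image_of_injective I (f := fun i => (i, i))
            fun i j h => congrArg Prod.fst h]
          refine Finset.card_le_card fun q hq => ?_
          obtain ⟨i, hi, rfl⟩ := Finset.mem_image.1 hq
          exact Finset.mem_filter.2 ⟨Finset.mem_product.2 ⟨hi, hi⟩, fun h => h.1 rfl⟩
        have h1 : (I.card : ℝ) ≤ 1 / 4 * (I.card : ℝ) ^ 2 := (Nat.cast_le.2 hdiag).trans hbad1
        have h4 : (4 : ℝ) ≤ I.card := by nlinarith
        have h2 : 1 < (I.filter fun i => Z ≤ E i).card := by
          have : (1 : ℝ) < (I.filter fun i => Z ≤ E i).card := by linarith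
          exact_mod_cast this
        obtain ⟨a, ha, b, hb, hab⟩ := Finset.one_lt_card.1 h2
        rw [Finset.mem_filter] at ha hb
        refine le_antisymm ?_ (Nat.one_le_iff_ne_zero.2 fun h =>
          hZbot (Submodule.finrank_eq_zero.1 h))
        exact (Submodule.finrank_mono (le_inf ha.2 hb.2)).trans (hE a ha.1 b hb.1 hab)
      · refine le_trans ?_ hA
        have := mul_le_mul_of_nonneg_right (min_le_right (c / (2 * M)) (1 / 2)) hn.le
        linarith
    · set I₀ := I.filter fun i => ¬ Z ≤ E i with hI₀
      have hI₀I : I₀ ⊆ I := Finset.filter_subset _ _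
      have hsum : ((I.filter fun i => Z ≤ E i).card : ℝ) + I₀.card = I.card := by
        exact_mod_cast Finset.card_filter_add_card_filter_not (s := I) fun i => Z ≤ E i
      have hI₀card : (I.card : ℝ) ≤ 2 * I₀.card := by linarith
      have hI₀ne : I₀.Nonempty := by
        rw [← Finset.card_pos, ← Nat.cast_pos (α := ℝ)]
        linarith
      have himage : ∀ J ⊆ I, ∀ i ∈ J, (((J.erase i).image fun j => E i ⊓ E j).card : ℝ) ≤
          ((I.erase i).image fun j => E i ⊓ E j).card := fun J hJ i _ =>
        Nat.cast_le.2 (Finset.card_le_card (Finset.image_subset_image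
          (Finset.erase_subset_erase _ hJ)))
      obtain ⟨J, hJI₀, Z', hZ', hJcard, hJbad⟩ := exists_smaller_subspace E I₀ hI₀ne
        (fun i hi j hj => hE i (hI₀I hi) j (hI₀I hj)) Z hZbot
        (fun i hi => (Finset.mem_filter.1 hi).2) _
        (fun i hi => (himage I₀ hI₀I i hi).trans (hR i (hI₀I hi)))
      have hJI := hJI₀.trans hI₀I
      have hJcard' : (I.card : ℝ) ≤ 2 * M * J.card := by
        have h : (I₀.card : ℝ) ≤ finrank ℝ Z * J.card := by exact_mod_cast hJcard
        have : (finrank ℝ Z : ℝ) * J.card ≤ M * J.card := by gcongr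
        linarith
      have hJ0 : (0 : ℝ) < J.card := by
        by_contra! h
        nlinarith
      have hJne : J.Nonempty := Finset.card_pos.1 (by exact_mod_cast hJ0)
      have hbad₀ : (((I₀ ×ˢ I₀).filter fun p => ¬ MeetsIn E Z p.1 p.2).card : ℝ) ≤
          η / (136 * M ^ 3) * (I.card : ℝ) ^ 2 := by
        refine le_trans (Nat.cast_le.2 (Finset.card_le_card (Finset.filter_subset_filter _
          (Finset.product_subset_product hI₀I hI₀I)))) (hbad.trans ?_)
        gcongr
        exact min_le_left _ _
      have hJbad' : (((J ×ˢ J).filter fun p => ¬ MeetsIn E Z' p.1 p.2).card : ℝ) ≤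
          η * (J.card : ℝ) ^ 2 := by
        refine hJbad.trans ?_
        calc _ ≤ 16 * M ^ 2 * (η / (64 * M ^ 3) * (2 * M * J.card)) * J.card +
              17 * M * (η / (136 * M ^ 3) * (2 * M * J.card) ^ 2) := by
              gcongr
              · exact min_le_left _ _
              · exact hbad₀.trans (by gcongr)
          _ = η * (J.card : ℝ) ^ 2 := by
              field_simp
              ring
      have hJR : ∀ i ∈ J, (((J.erase i).image fun j => E i ⊓ E j).card : ℝ) ≤ δ * J.card := by
        intro i hi
        refine (himage J hJI i hi).trans ((hR i (hJI hi)).trans ?_)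
        calc _ ≤ δ / (2 * M) * (2 * M * J.card) := by
              gcongr
              exact min_le_right _ _
          _ = δ * J.card := by field_simp
      obtain ⟨x, hx, hxJ⟩ := ih E J hJne (fun i hi j hj => hE i (hJI hi) j (hJI hj)) Z'
        (Nat.le_of_lt_succ ((Submodule.finrank_lt_finrank_of_lt hZ').trans_le hZ)) hJbad' hJR
      refine ⟨x, hx, ?_⟩
      calc min (c / (2 * M)) (1 / 2) * (I.card : ℝ) ≤ c / (2 * M) * (2 * M * J.card) := by
            gcongr
            exact min_le_left _ _
        _ = c * J.card := by field_simp
        _ ≤ _ := hxJ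
        _ ≤ _ := Nat.cast_le.2 (Finset.card_le_card (Finset.filter_subset_filter _ hJI))

/-- The linear subspace of `W × ℝ` spanned by `F × {1}`, for a point `a` of `F`. -/
def homogenization {W : Type*} [AddCommGroup W] [Module ℝ W] (F : AffineSubspace ℝ W) (a : W) :
    Submodule ℝ (W × ℝ) :=
  F.direction.comap (LinearMap.fst ℝ W ℝ - (LinearMap.snd ℝ W ℝ).smulRight a)

theorem mem_homogenization {W : Type*} [AddCommGroup W] [Module ℝ W] {F : AffineSubspace ℝ W}
    {a x : W} (ha : a ∈ F) (hx : x ∈ F) (v : W × ℝ) :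
    v ∈ homogenization F a ↔ v.1 - v.2 • x ∈ F.direction := by
  have h : v.2 • (x - a) ∈ F.direction :=
    Submodule.smul_mem _ _ (AffineSubspace.vsub_mem_direction hx ha)
  have h' : v.1 - v.2 • a = v.1 - v.2 • x + v.2 • (x - a) := by
    rw [smul_sub]
    abel
  change v.1 - v.2 • a ∈ F.direction ↔ _
  rw [h', Submodule.add_mem_iff_left _ h]

theorem mk_one_mem_homogenization {W : Type*} [AddCommGroup W] [Module ℝ W]
    {F : AffineSubspace ℝ W} {a : W} (ha : a ∈ F) (y : W) :
    (y, (1 : ℝ)) ∈ homogenization F a ↔ y ∈ F := by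
  rw [mem_homogenization ha ha, one_smul]
  exact AffineSubspace.vsub_right_mem_direction_iff_mem ha y

theorem homogenization_inf {W : Type*} [AddCommGroup W] [Module ℝ W]
    {F F' : AffineSubspace ℝ W} {a a' x : W} (ha : a ∈ F) (ha' : a' ∈ F')
    (hx : x ∈ F) (hx' : x ∈ F') (huniq : ∀ y, y ∈ F → y ∈ F' → y = x) :
    homogenization F a ⊓ homogenization F' a' = Submodule.span ℝ {(x, (1 : ℝ))} := by
  refine le_antisymm (fun v hv => ?_) ?_
  · rw [Submodule.mem_inf, mem_homogenization ha hx, mem_homogenization ha' hx'] at hv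
    have h := huniq (v.1 - v.2 • x + x) (AffineSubspace.vadd_mem_of_mem_direction hv.1 hx)
      (AffineSubspace.vadd_mem_of_mem_direction hv.2 hx')
    rw [add_eq_right, sub_eq_zero] at h
    exact Submodule.mem_span_singleton.2 ⟨v.2, Prod.ext h.symm (mul_one _)⟩
  · rw [Submodule.span_singleton_le_iff_mem]
    exact ⟨(mk_one_mem_homogenization ha x).2 hx, (mk_one_mem_homogenization ha' x).2 hx'⟩

open Classical in
theorem exists_concurrent_or_linear_incidences (W : Type*) [AddCommGroup W] [Module ℝ W]
    [FiniteDimensional ℝ W] :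
    ∃ c : ℝ, 0 < c ∧ ∀ L : Finset (AffineSubspace ℝ W),
      (∀ F ∈ L, (F : Set W).Nonempty) →
      (∀ F ∈ L, ∀ F' ∈ L, F ≠ F' → ∃! x : W, x ∈ F ∧ x ∈ F') →
      (∃ x : W, ∀ F ∈ L, x ∈ F) ∨
        ∃ F ∈ L, c * L.card ≤ ({x : W | x ∈ F ∧ ∃ F' ∈ L, F' ≠ F ∧ x ∈ F'}.ncard : ℝ) := by
  set V := EuclideanSpace ℝ (Fin (finrank ℝ (W × ℝ)))
  have e : (W × ℝ) ≃ₗ[ℝ] V := LinearEquiv.ofFinrankEq _ _ (by simp [V])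
  obtain ⟨η, δ, c, hη, hδ, hc, key⟩ :=
    exists_popular_line V (AffineSubspace ℝ W) (finrank ℝ V)
  refine ⟨min η (min δ (c / 2)), by positivity, fun L hne hL => ?_⟩
  by_contra! hcon
  obtain ⟨hconc, hfew⟩ := hcon
  set c₀ := min η (min δ (c / 2)) with hc₀
  have hc₀η : c₀ ≤ η := min_le_left _ _
  have hc₀δ : c₀ ≤ δ := (min_le_right _ _).trans (min_le_left _ _)
  have hc₀c : c₀ ≤ c / 2 := (min_le_right _ _).trans (min_le_right _ _)
  set S : AffineSubspace ℝ W → Set W := fun F => {x | x ∈ F ∧ ∃ F' ∈ L, F' ≠ F ∧ x ∈ F'} with hS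
  have hfew : ∀ F ∈ L, ((S F).ncard : ℝ) < c₀ * L.card := hfew
  have hpt : ∀ F ∈ L, ∀ F' ∈ L, F ≠ F' → ∃ x : W, x ∈ F ∧ x ∈ F' ∧
      ∀ y, y ∈ F → y ∈ F' → y = x := by
    intro F hF F' hF' h
    obtain ⟨x, hx, hu⟩ := hL F hF F' hF' h
    exact ⟨x, hx.1, hx.2, fun y h1 h2 => hu y ⟨h1, h2⟩⟩
  choose! t ht using hpt
  choose! a ha using hne
  have hSfin : ∀ F ∈ L, (S F).Finite := by
    intro F hF
    refine (L.finite_toSet.image (t F)).subset ?_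
    rintro x ⟨hx, F', hF', hne, hx'⟩
    exact ⟨F', hF', ((ht F hF F' hF' hne.symm).2.2 x hx hx').symm⟩
  have hn0 : (0 : ℝ) ≤ L.card := Nat.cast_nonneg _
  obtain ⟨F₁, hF₁, -⟩ := hconc 0
  have hlarge : 1 < c₀ * L.card := by
    obtain ⟨F₂, hF₂, h⟩ := hconc (a F₁)
    have hne : F₁ ≠ F₂ := by
      rintro rfl
      exact h (ha F₁ hF₁)
    have h12 := ht F₁ hF₁ F₂ hF₂ hne
    have : 0 < (S F₁).ncard :=
      (Set.ncard_pos (hSfin F₁ hF₁)).2 ⟨_, h12.1, F₂, hF₂, hne.symm, h12.2.1⟩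
    exact lt_of_le_of_lt (by exact_mod_cast this) (hfew F₁ hF₁)
  set E : AffineSubspace ℝ W → Submodule ℝ V := fun F =>
    Submodule.orderIsoMapComap e (homogenization F (a F)) with hE
  set q : W → Submodule ℝ V := fun x => Submodule.orderIsoMapComap e
    (Submodule.span ℝ {(x, (1 : ℝ))}) with hq
  have hqrank : ∀ x, finrank ℝ (q x) = 1 := by
    intro x
    rw [← finrank_span_singleton (K := ℝ) (v := (x, (1 : ℝ)))
      fun h => one_ne_zero (congrArg Prod.snd h)]
    exact LinearEquiv.finrank_map_eq e _
  have hinf : ∀ F ∈ L, ∀ F' ∈ L, F ≠ F' → E F ⊓ E F' = q (t F F') := by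
    intro F hF F' hF' h
    have h' := ht F hF F' hF' h
    rw [hE, hq, ← OrderIso.map_inf,
      homogenization_inf (ha F hF) (ha F' hF') h'.1 h'.2.1 h'.2.2]
  have hqE : ∀ F ∈ L, ∀ y, q y ≤ E F ↔ y ∈ F := by
    intro F hF y
    rw [hE, hq, OrderIso.le_iff_le, Submodule.span_singleton_le_iff_mem,
      mk_one_mem_homogenization (ha F hF)]
  obtain ⟨x, hx, hxcard⟩ := key E L ⟨F₁, hF₁⟩
    (fun F hF F' hF' h => by rw [hinf F hF F' hF' h, hqrank]) ⊤ (Submodule.finrank_le _)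
    (by
      have h : ((L ×ˢ L).filter fun p => ¬ MeetsIn E ⊤ p.1 p.2) ⊆ L.image fun F => (F, F) := by
        intro p hp
        obtain ⟨hp, hm⟩ := Finset.mem_filter.1 hp
        obtain ⟨h1, h2⟩ := Finset.mem_product.1 hp
        refine Finset.mem_image.2 ⟨p.1, h1, Prod.ext rfl ?_⟩
        by_contra hne
        refine hm ⟨hne, fun h0 => ?_, le_top⟩
        have := hqrank (t p.1 p.2)
        rw [← hinf _ h1 _ h2 hne, h0, finrank_bot] at this
        exact zero_ne_one this
      have h' : (((L ×ˢ L).filter fun p => ¬ MeetsIn E ⊤ p.1 p.2).card : ℝ) ≤ L.card :=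
        Nat.cast_le.2 ((Finset.card_le_card h).trans Finset.card_image_le)
      nlinarith)
    (by
      intro F hF
      have h : (((L.erase F).image fun F' => E F ⊓ E F' : Finset (Submodule ℝ V)) :
          Set (Submodule ℝ V)) ⊆ q '' S F := by
        intro y hy
        obtain ⟨F', hF', rfl⟩ := Finset.mem_image.1 hy
        obtain ⟨hne, hF'⟩ := Finset.mem_erase.1 hF'
        have h' := ht F hF F' hF' hne.symm
        exact ⟨_, ⟨h'.1, F', hF', hne, h'.2.1⟩, (hinf F hF F' hF' hne.symm).symm⟩
      have h1 := (Set.ncard_le_ncard h ((hSfin F hF).image q)).trans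
        (Set.ncard_image_le (hSfin F hF))
      rw [Set.ncard_coe_finset] at h1
      calc _ ≤ ((S F).ncard : ℝ) := Nat.cast_le.2 h1
        _ ≤ c₀ * L.card := (hfew F hF).le
        _ ≤ _ := by gcongr)
  have htwo : 1 < (L.filter fun F => x ≤ E F).card := by
    have : (1 : ℝ) < (L.filter fun F => x ≤ E F).card := by nlinarith
    exact_mod_cast this
  obtain ⟨G, hG, G', hG', hGG'⟩ := Finset.one_lt_card.1 htwo
  rw [Finset.mem_filter] at hG hG'
  have hxbot : x ≠ ⊥ := by
    rintro rfl
    rw [finrank_bot] at hx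
    exact zero_ne_one hx
  have hxq : x = q (t G G') := by
    rw [← hinf G hG.1 G' hG'.1 hGG']
    exact eq_inf_of_le (by rw [hinf G hG.1 G' hG'.1 hGG', hqrank]) hxbot hG.2 hG'.2
  set y := t G G'
  obtain ⟨F₀, hF₀, hy⟩ := hconc y
  have hmem : ∀ F ∈ L.filter (fun F => x ≤ E F), F ∈ L ∧ y ∈ F ∧ F ≠ F₀ := by
    intro F hF
    obtain ⟨hF, hxF⟩ := Finset.mem_filter.1 hF
    rw [hxq, hqE F hF] at hxF
    exact ⟨hF, hxF, fun h => hy (h ▸ hxF)⟩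
  have hle : (L.filter fun F => x ≤ E F).card ≤ (S F₀).ncard := by
    rw [← Set.ncard_coe_finset]
    refine Set.ncard_le_ncard_of_injOn (t F₀) (fun F hF => ?_) (fun F hF F' hF' h => ?_)
      (hSfin F₀ hF₀)
    · obtain ⟨hF, -, hne⟩ := hmem F hF
      have h := ht F₀ hF₀ F hF hne.symm
      exact ⟨h.1, F, hF, hne, h.2.1⟩
    · obtain ⟨hF, hyF, hne⟩ := hmem F hF
      obtain ⟨hF', hyF', hne'⟩ := hmem F' hF'
      by_contra hFF'
      have h1 := ht F₀ hF₀ F hF hne.symm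
      have h2 := ht F₀ hF₀ F' hF' hne'.symm
      have h3 := (ht F hF F' hF' hFF').2.2
      rw [h3 y hyF hyF', ← h3 _ h1.2.1 (h ▸ h2.2.1)] at hy
      exact hy h1.1
  have h1 : c * L.card ≤ ((S F₀).ncard : ℝ) := hxcard.trans (Nat.cast_le.2 hle)
  have h2 := hfew F₀ hF₀
  nlinarith

end LinearIncidences

/-- for every `ε > 0`, `p ≥ 1`, `d ≥ 2p` there is `c > 0` such that every
family `L` of `n` distinct `p`-dimensional affine subspaces of `ℝ^d`, any two of which meet
in exactly one point, either passes through a single common point or contains a member `F`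
incident to at least `c·n^{1−ε}` intersection points of the family. -/
theorem stmt_12 (ε : ℝ) (hε : 0 < ε) (p d : ℕ) (hp : 1 ≤ p) (hd : 2 * p ≤ d) :
    ∃ c : ℝ, 0 < c ∧
      ∀ (n : ℕ) (L : Finset (AffineSubspace ℝ (Fin d → ℝ))),
        L.card = n →
        (∀ F ∈ L, (F : Set (Fin d → ℝ)).Nonempty) →
        (∀ F ∈ L, Module.finrank ℝ F.direction = p) →
        (∀ F ∈ L, ∀ F' ∈ L, F ≠ F' → ∃! x : Fin d → ℝ, x ∈ F ∧ x ∈ F') →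
        ((∃ x : Fin d → ℝ, ∀ F ∈ L, x ∈ F) ∨
          ∃ F ∈ L, c * (n : ℝ) ^ (1 - ε) ≤
            (({x : Fin d → ℝ | x ∈ F ∧ ∃ F' ∈ L, F' ≠ F ∧ x ∈ F'}.ncard : ℕ) : ℝ)) := by
  obtain ⟨c, hc, h⟩ := exists_concurrent_or_linear_incidences (Fin d → ℝ)
  refine ⟨c, hc, ?_⟩
  rintro _ L rfl hne - hL
  refine (h L hne hL).imp_right ?_
  rintro ⟨F, hF, hcard⟩
  refine ⟨F, hF, le_trans ?_ hcard⟩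
  have h1 : (1 : ℝ) ≤ L.card := by exact_mod_cast Finset.card_pos.2 ⟨F, hF⟩
  gcongr
  calc (L.card : ℝ) ^ (1 - ε) ≤ (L.card : ℝ) ^ (1 : ℝ) :=
        Real.rpow_le_rpow_of_exponent_le h1 (by linarith)
    _ = L.card := Real.rpow_one _
end
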